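/- arXiv:1608.05287 — 8 statements merged into one kernel-verified Lean document; each statement's English description precedes it below -/
import Mathlib

section
/- Let K be a field of prime characteristic p with [K:K^p] < ∞, let S be either the polynomial ring K[x_1,…,x_n] or the formal power series ring K[[x_1,…,x_n]], let f ∈ S be a nonzero nonunit, set R = S/fS, and fix e ≥ 1 with q = p^e and r_e = [K:K^p]^e · q^n. Then: (1) F_*^e(S) is a free S-module of rank r_e; (2) for each 1 ≤ k ≤ q−1 the S-linear endomorphism μ_k of F_*^e(S) defined by μ_k(F_*^e(s)) = F_*^e(f^k s) satisfies μ_k ∘ μ_{q−k} = f · id (so the matrices representing μ_1 and μ_{q−1} in a free basis form a matrix factorization of f of size r_e); and (3) F_*^e(R) is isomorphic, as an S-module (and hence as an R-module), to the cokernel of μ_1. -/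
open scoped DirectSum

universe u v w

/-- `FrobIso R q M N` states that the `R`-module `M` with scalar action twisted by `r ↦ r ^ q`
(that is, the Frobenius pushforward `F_*ᵉ M` when `q = p ^ e`) is isomorphic to the `R`-module
`N`: there is an additive isomorphism `g : M ≃+ N` with `g (r ^ q • m) = r • g m`. -/
def FrobIso (R : Type u) [CommSemiring R] (q : ℕ)
    (M : Type v) [AddCommMonoid M] [Module R M]
    (N : Type w) [AddCommMonoid N] [Module R N] : Prop :=
  ∃ g : M ≃+ N, ∀ (r : R) (m : M), g (r ^ q • m) = r • g m

/-- A module `N` over a ring `R` of prime characteristic `p` has finite F-representation type: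
there are finitely many finitely generated `R`-modules `M 0, …, M (s-1)` such that for every
`e ≥ 1` the Frobenius pushforward `F_*ᵉ N` is isomorphic to a finite direct sum of copies of
the `M i`. -/
def HasFFRTModule (p : ℕ) (R : Type u) [CommRing R]
    (N : Type v) [AddCommMonoid N] [Module R N] : Prop :=
  ∃ (s : ℕ) (M : Fin s → ModuleCat.{u} R),
    (∀ i, Module.Finite R (M i)) ∧
    ∀ e : ℕ, 1 ≤ e → ∃ t : Fin s → ℕ,
      FrobIso R (p ^ e) N (⨁ i, Fin (t i) → ↥(M i))

/-- A ring `R` of prime characteristic `p` has finite F-representation type. -/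
def HasFFRT (p : ℕ) (R : Type u) [CommRing R] : Prop :=
  HasFFRTModule p R R

/-- The `e`-th iterated Frobenius `x ↦ x ^ p ^ e` as a ring homomorphism. -/
noncomputable def frobPow (R : Type u) [CommSemiring R] (p : ℕ) [Fact p.Prime] [CharP R p]
    (e : ℕ) : R →+* R :=
  haveI : ExpChar R p := .prime Fact.out
  iterateFrobenius R p e

/-- `F_*ᵉ M` : the module `M` with `R`-action `r • m = r ^ p ^ e • m`. -/
@[nolint unusedArguments]
def FStar (R : Type u) [CommSemiring R] (p e : ℕ) [Fact p.Prime] [CharP R p]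
    (M : Type v) [AddCommMonoid M] [Module R M] : Type v := M

instance (R : Type u) [CommSemiring R] (p e : ℕ) [Fact p.Prime] [CharP R p]
    (M : Type v) [AddCommMonoid M] [Module R M] : AddCommMonoid (FStar R p e M) :=
  inferInstanceAs (AddCommMonoid M)

instance (R : Type u) [CommSemiring R] (p e : ℕ) [Fact p.Prime] [CharP R p]
    (M : Type v) [AddCommGroup M] [Module R M] : AddCommGroup (FStar R p e M) :=
  inferInstanceAs (AddCommGroup M)

noncomputable instance (R : Type u) [CommSemiring R] (p e : ℕ) [Fact p.Prime] [CharP R p]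
    (M : Type v) [AddCommMonoid M] [Module R M] : Module R (FStar R p e M) :=
  Module.compHom M (frobPow R p e)

instance (R : Type u) [CommRing R] (p e : ℕ) [Fact p.Prime] [CharP R p]
    (M : Type v) [AddCommMonoid M] [Module R M] : SMulCommClass R R (FStar R p e M) where
  smul_comm a b m := by
    rw [smul_smul, smul_smul, mul_comm]

/-- `a` is the maximal rank of a free direct summand of the Frobenius pushforward `F_*ᵉ R`:
`F_*ᵉ R ≅ Rᵃ ⊕ L` where `L` has no nonzero free direct summand. -/
def IsMaxFreeRank (p e : ℕ) (R : Type u) [CommRing R] (a : ℕ) : Prop :=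
  ∃ L : ModuleCat.{u} R,
    FrobIso R (p ^ e) R ((Fin a → R) × ↥L) ∧
    ¬ ∃ L' : ModuleCat.{u} R, Nonempty (↥L ≃ₗ[R] R × ↥L')

/-- `N` is an indecomposable `R`-module: it is nonzero and is not the (internal) direct sum
of two nonzero submodules. -/
def IsIndecomposable (R : Type u) [Ring R] (N : Type v) [AddCommGroup N] [Module R N] : Prop :=
  Nontrivial N ∧ ∀ A B : Submodule R N, IsCompl A B → A = ⊥ ∨ B = ⊥

/-- Reinterpret `m : M` as an element of `F_*ᵉ M`. -/
def FStar.mk (R : Type u) [CommSemiring R] (p e : ℕ) [Fact p.Prime] [CharP R p]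
    (M : Type v) [AddCommMonoid M] [Module R M] (m : M) : FStar R p e M := m

/-- The element of `M` underlying an element of `F_*ᵉ M`. -/
def FStar.get (R : Type u) [CommSemiring R] (p e : ℕ) [Fact p.Prime] [CharP R p]
    (M : Type v) [AddCommMonoid M] [Module R M] (m : FStar R p e M) : M := m

/-- Multiplication by `g` as an `S`-linear endomorphism of `F_*ᵉ S`; for `g = f ^ k` this is
the map `μ_k : F_*ᵉ(s) ↦ F_*ᵉ(f ^ k ⬝ s)`. -/
noncomputable def mulMap (S : Type u) [CommRing S] (p e : ℕ) [Fact p.Prime] [CharP S p]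
    (g : S) : FStar S p e S →ₗ[S] FStar S p e S where
  toFun s := FStar.mk S p e S (g * FStar.get S p e S s)
  map_add' a b :=
    congrArg (FStar.mk S p e S) (mul_add g (FStar.get S p e S a) (FStar.get S p e S b))
  map_smul' r s := by
    show FStar.mk S p e S (g * FStar.get S p e S (r • s)) =
      r • FStar.mk S p e S (g * FStar.get S p e S s)
    have h1 : FStar.get S p e S (r • s) = frobPow S p e r * FStar.get S p e S s := rfl
    have h2 : ∀ x : S, r • FStar.mk S p e S x = FStar.mk S p e S (frobPow S p e r * x) :=
      fun _ => rfl
    rw [h1, h2]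
    exact congrArg (FStar.mk S p e S) (by ring)

theorem FStar.smul_def {R : Type u} [CommSemiring R] {p e : ℕ} [Fact p.Prime] [CharP R p]
    {M : Type v} [AddCommMonoid M] [Module R M] (r : R) (m : FStar R p e M) :
    r • m = FStar.mk R p e M (r ^ p ^ e • FStar.get R p e M m) := rfl

/-- Every element of `R` is uniquely of the form `∑ i, c i ^ q * β i`. When `q` is a power of the
characteristic, this says that `β` is a basis of the corresponding Frobenius pushforward of `R`. -/
def IsFrobBasis {R : Type u} [CommRing R] (q : ℕ) {ι : Type v} [Fintype ι] (β : ι → R) : Prop :=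
  Function.Bijective fun c : ι → R ↦ ∑ i, c i ^ q * β i

namespace IsFrobBasis

variable {R : Type u} [CommRing R] {ι : Type v} [Fintype ι] {q : ℕ} {β : ι → R}

theorem of_basis {p e : ℕ} [Fact p.Prime] [CharP R p] (B : Module.Basis ι R (FStar R p e R)) :
    IsFrobBasis (p ^ e) fun i ↦ FStar.get R p e R (B i) := by
  have h := B.equivFun.symm.bijective
  have h2 : (B.equivFun.symm : (ι → R) → FStar R p e R) =
      fun c : ι → R ↦ ∑ i, c i ^ p ^ e * FStar.get R p e R (B i) := by
    funext c
    rw [Module.Basis.equivFun_symm_apply]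
    rfl
  rw [h2] at h
  exact h

/-- The basis of the Frobenius pushforward of `R` given by a Frobenius basis. -/
noncomputable def basis {p e : ℕ} [Fact p.Prime] [CharP R p] (h : IsFrobBasis (p ^ e) β) :
    Module.Basis ι R (FStar R p e R) :=
  Module.Basis.ofEquivFun (LinearEquiv.ofBijective
    (Fintype.linearCombination R fun i ↦ FStar.mk R p e R (β i)) h).symm

theorem map {S : Type w} [CommRing S] (φ : R ≃+* S) (h : IsFrobBasis q β) :
    IsFrobBasis q fun i ↦ φ (β i) := by
  have h1 := (φ.bijective.comp h).comp (Equiv.arrowCongr (Equiv.refl ι) φ.toEquiv.symm).bijective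
  unfold IsFrobBasis
  convert h1 using 2 with c
  simp [map_sum, map_mul, map_pow]

theorem mul {p e e' : ℕ} [Fact p.Prime] [CharP R p] {κ : Type w} [Fintype κ] {γ : κ → R}
    (h : IsFrobBasis (p ^ e) β) (h' : IsFrobBasis (p ^ e') γ) :
    IsFrobBasis (p ^ (e + e')) fun x : κ × ι ↦ β x.2 ^ p ^ e' * γ x.1 := by
  have h1 := (h'.comp (Function.Bijective.piMap fun _ : κ ↦ h)).comp (Equiv.curry κ ι R).bijective
  have : ExpChar R p := .prime Fact.out
  unfold IsFrobBasis
  convert h1 using 2 with c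
  simp only [Function.comp_apply, Fintype.sum_prod_type]
  refine Finset.sum_congr rfl fun j _ ↦ ?_
  simp only [Pi.map_apply, Equiv.curry_apply,
    Function.curry_apply, sum_pow_char_pow, Finset.sum_mul]
  exact Finset.sum_congr rfl fun i _ ↦ by ring

theorem exists_iterate {p b : ℕ} [Fact p.Prime] [CharP R p] {β : Fin b → R}
    (h : IsFrobBasis (p ^ 1) β) (e : ℕ) :
    ∃ (ι : Type) (_ : Fintype ι) (γ : ι → R), Fintype.card ι = b ^ e ∧ IsFrobBasis (p ^ e) γ := by
  induction e with
  | zero =>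
    refine ⟨Unit, inferInstance, fun _ ↦ 1, by simp, ?_⟩
    unfold IsFrobBasis
    convert (Equiv.funUnique Unit R).bijective using 2 with c
    simp
  | succ e ih =>
    obtain ⟨ι, _, γ, hι, hγ⟩ := ih
    exact ⟨Fin b × ι, inferInstance, _, by simp [hι, pow_succ, mul_comm], hγ.mul h⟩

end IsFrobBasis

/-- The exponent vector of a family of natural numbers smaller than `q`. -/
noncomputable def finExponent {n q : ℕ} (d : Fin n → Fin q) : Fin n →₀ ℕ :=
  Finsupp.equivFunOnFinite.symm fun i ↦ (d i : ℕ)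

@[simp]
theorem finExponent_apply {n q : ℕ} (d : Fin n → Fin q) (i : Fin n) :
    finExponent d i = d i := rfl

theorem exists_smul_add_finExponent {n q : ℕ} (hq : 0 < q) (m : Fin n →₀ ℕ) :
    ∃ (a : Fin n →₀ ℕ) (d : Fin n → Fin q), m = q • a + finExponent d :=
  ⟨Finsupp.equivFunOnFinite.symm fun i ↦ m i / q, fun i ↦ ⟨m i % q, Nat.mod_lt _ hq⟩, by
    ext i
    simp [Nat.div_add_mod]⟩

theorem MvPolynomial.coe_frob_sum {K : Type u} [Field K] {n q : ℕ} {ι : Type} [Fintype ι]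
    {β : ι → K} (c : ι × (Fin n → Fin (q)) → MvPolynomial (Fin n) K) :
    ((∑ x, c x ^ q * monomial (finExponent x.2) (β x.1) : MvPolynomial (Fin n) K) :
      MvPowerSeries (Fin n) K) =
      ∑ x, (c x : MvPowerSeries (Fin n) K) ^ q *
        MvPowerSeries.monomial (finExponent x.2) (β x.1) := by
  rw [← MvPolynomial.coeToMvPowerSeries.ringHom_apply, map_sum]
  simp

section

variable {K : Type u} [Field K] {p n e : ℕ} [Fact p.Prime] [CharP K p]

theorem MvPowerSeries.coeff_pow_char_pow_smul (c : MvPowerSeries (Fin n) K) (m : Fin n →₀ ℕ) :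
    coeff (p ^ e • m) (c ^ p ^ e) = coeff m c ^ p ^ e := by
  have : ExpChar K p := .prime Fact.out
  rw [← map_iterateFrobenius_expand p (Fact.out : p.Prime).ne_zero, coeff_map, coeff_expand_smul,
    iterateFrobenius_def]

theorem MvPowerSeries.coeff_pow_char_pow_of_not_dvd (c : MvPowerSeries (Fin n) K)
    {m : Fin n →₀ ℕ} {i : Fin n} (h : ¬ p ^ e ∣ m i) : coeff m (c ^ p ^ e) = 0 := by
  have : ExpChar K p := .prime Fact.out
  rw [← map_iterateFrobenius_expand p (Fact.out : p.Prime).ne_zero, coeff_map,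
    coeff_expand_of_not_dvd _ _ _ h, map_zero]

theorem MvPowerSeries.coeff_pow_mul_monomial (c : MvPowerSeries (Fin n) K) (a : K)
    (m : Fin n →₀ ℕ) (d d' : Fin n → Fin (p ^ e)) :
    coeff (p ^ e • m + finExponent d) (c ^ p ^ e * monomial (finExponent d') a) =
      if d' = d then coeff m c ^ p ^ e * a else 0 := by
  split_ifs with h
  · rw [h, coeff_add_mul_monomial, coeff_pow_char_pow_smul]
  · rw [coeff_mul_monomial]
    split_ifs with hle
    · obtain ⟨i, hi⟩ := Function.ne_iff.mp h
      rw [coeff_pow_char_pow_of_not_dvd (i := i), zero_mul]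
      intro hdvd
      refine hi (Fin.ext ?_)
      have h1 := hle i
      obtain ⟨k, hk⟩ := hdvd
      simp only [Finsupp.coe_tsub, Finsupp.coe_add, Finsupp.coe_smul, Pi.sub_apply, Pi.add_apply,
        Pi.smul_apply, finExponent_apply, smul_eq_mul] at hk h1
      have h2 : p ^ e * m i + d i = p ^ e * k + d' i := by omega
      have h3 := congrArg (· % p ^ e) h2
      simp only [Nat.mul_add_mod, Nat.mod_eq_of_lt (d i).2, Nat.mod_eq_of_lt (d' i).2] at h3
      exact h3.symm
    · rfl

variable {ι : Type} [Fintype ι] {β : ι → K}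

theorem MvPowerSeries.coeff_frob_sum (c : ι × (Fin n → Fin (p ^ e)) → MvPowerSeries (Fin n) K)
    (m : Fin n →₀ ℕ) (d : Fin n → Fin (p ^ e)) :
    coeff (p ^ e • m + finExponent d)
      (∑ x, c x ^ p ^ e * monomial (finExponent x.2) (β x.1)) =
      ∑ i, coeff m (c (i, d)) ^ p ^ e * β i := by
  simp only [map_sum, coeff_pow_mul_monomial, Fintype.sum_prod_type]
  simp

theorem MvPowerSeries.isFrobBasis_monomial (h : IsFrobBasis (p ^ e) β) :
    IsFrobBasis (p ^ e) fun x : ι × (Fin n → Fin (p ^ e)) ↦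
      (monomial (finExponent x.2) (β x.1) : MvPowerSeries (Fin n) K) := by
  constructor
  · intro c c' hcc
    funext ⟨i, d⟩
    ext m
    have h1 := congrArg (coeff (p ^ e • m + finExponent d)) hcc
    simp only [coeff_frob_sum] at h1
    exact congrFun (h.1 (a₁ := fun i ↦ coeff m (c (i, d)))
      (a₂ := fun i ↦ coeff m (c' (i, d))) h1) i
  · intro f
    choose a ha using h.2
    refine ⟨fun x m ↦ a (coeff (p ^ e • m + finExponent x.2) f) x.1, ?_⟩
    ext m
    obtain ⟨m, d, rfl⟩ := exists_smul_add_finExponent (pow_pos (Fact.out : p.Prime).pos e) m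
    refine (coeff_frob_sum _ m d).trans ?_
    change ∑ i, a (coeff (p ^ e • m + finExponent d) f) i ^ p ^ e * β i = _
    exact ha _

theorem MvPolynomial.exists_coe_eq {c : MvPowerSeries (Fin n) K}
    (hc : {m | MvPowerSeries.coeff m c ≠ 0}.Finite) :
    ∃ f : MvPolynomial (Fin n) K, (f : MvPowerSeries (Fin n) K) = c := by
  classical
  refine ⟨∑ m ∈ hc.toFinset, monomial m (MvPowerSeries.coeff m c), ?_⟩
  ext m
  rw [MvPolynomial.coeff_coe, MvPolynomial.coeff_sum]
  simp only [MvPolynomial.coeff_monomial, Finset.sum_ite_eq', Set.Finite.mem_toFinset,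
    Set.mem_ofPred_eq]
  split_ifs with hm
  · rfl
  · exact (not_not.mp hm).symm

theorem MvPolynomial.isFrobBasis_monomial (h : IsFrobBasis (p ^ e) β) :
    IsFrobBasis (p ^ e) fun x : ι × (Fin n → Fin (p ^ e)) ↦
      (monomial (finExponent x.2) (β x.1) : MvPolynomial (Fin n) K) := by
  have hps := MvPowerSeries.isFrobBasis_monomial (n := n) h
  constructor
  · intro c c' hcc
    have h1 := congrArg (fun f : MvPolynomial (Fin n) K ↦ (f : MvPowerSeries (Fin n) K)) hcc
    simp only [coe_frob_sum] at h1
    have h2 := hps.1 (a₁ := fun x ↦ (c x : MvPowerSeries (Fin n) K))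
      (a₂ := fun x ↦ (c' x : MvPowerSeries (Fin n) K)) h1
    funext x
    exact MvPolynomial.coe_injective _ _ (congrFun h2 x)
  · intro f
    obtain ⟨c, hc⟩ := hps.2 (f : MvPowerSeries (Fin n) K)
    have hfin : ∀ x, ∃ g : MvPolynomial (Fin n) K, (g : MvPowerSeries (Fin n) K) = c x := by
      rintro ⟨i, d⟩
      apply exists_coe_eq
      have hinj : Function.Injective fun m : Fin n →₀ ℕ ↦ p ^ e • m + finExponent d :=
        fun m m' hm ↦ (smul_right_injective _ (pow_pos (Fact.out : p.Prime).pos e).ne')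
          (add_right_cancel hm)
      refine (f.support.finite_toSet.preimage hinj.injOn).subset fun m hm ↦ ?_
      simp only [Set.mem_preimage, Finset.mem_coe, mem_support_iff]
      intro h0
      have h1 := congrArg (MvPowerSeries.coeff (p ^ e • m + finExponent d)) hc
      simp only [MvPowerSeries.coeff_frob_sum, coeff_coe, h0] at h1
      refine hm (congrFun (h.1 (a₁ := fun i ↦ MvPowerSeries.coeff m (c (i, d))) (a₂ := 0) ?_) i)
      simp [h1, (Fact.out : p.Prime).ne_zero]
    choose g hg using hfin
    refine ⟨g, MvPolynomial.coe_injective _ _ ?_⟩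
    simp only [coe_frob_sum, hg]
    exact hc

end

theorem mulMap_comp_mulMap {S : Type u} [CommRing S] {p e : ℕ} [Fact p.Prime] [CharP S p]
    (f : S) {k : ℕ} (hk : k ≤ p ^ e) :
    (mulMap S p e (f ^ k)).comp (mulMap S p e (f ^ (p ^ e - k))) =
      f • (LinearMap.id : FStar S p e S →ₗ[S] FStar S p e S) := by
  refine LinearMap.ext fun s ↦ ?_
  change f ^ k * (f ^ (p ^ e - k) * FStar.get S p e S s) = f ^ p ^ e * FStar.get S p e S s
  rw [← mul_assoc, ← pow_add, Nat.add_sub_cancel' hk]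

/-- The projection `F_*ᵉ S → F_*ᵉ (S ⧸ I)`. -/
def FStar.mkQ (S : Type u) [CommRing S] (p e : ℕ) [Fact p.Prime] [CharP S p] (I : Ideal S) :
    FStar S p e S →ₗ[S] FStar S p e (S ⧸ I) where
  toFun s := FStar.mk S p e (S ⧸ I) (I.mkQ (FStar.get S p e S s))
  map_add' a b := I.mkQ.map_add (FStar.get S p e S a) (FStar.get S p e S b)
  map_smul' r s := I.mkQ.map_smul (r ^ p ^ e) (FStar.get S p e S s)

theorem FStar.mkQ_surjective (S : Type u) [CommRing S] (p e : ℕ) [Fact p.Prime] [CharP S p]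
    (I : Ideal S) : Function.Surjective (FStar.mkQ S p e I) :=
  I.mkQ_surjective

theorem FStar.ker_mkQ_span_singleton (S : Type u) [CommRing S] (p e : ℕ) [Fact p.Prime] [CharP S p]
    (f : S) : LinearMap.ker (FStar.mkQ S p e (Ideal.span {f})) =
      LinearMap.range (mulMap S p e f) := by
  ext s
  have h : s ∈ LinearMap.ker (FStar.mkQ S p e (Ideal.span {f})) ↔
      (Ideal.span {f}).mkQ (FStar.get S p e S s) = 0 := Iff.rfl
  rw [h, Submodule.mkQ_apply, Submodule.Quotient.mk_eq_zero, Ideal.mem_span_singleton']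
  exact exists_congr fun a ↦ by
    rw [mul_comm]
    rfl

theorem FStar.nonempty_quotient_equiv (S : Type u) [CommRing S] (p e : ℕ) [Fact p.Prime]
    [CharP S p] (f : S) :
    Nonempty ((FStar S p e (S ⧸ Ideal.span {f})) ≃ₗ[S]
      ((FStar S p e S) ⧸ LinearMap.range (mulMap S p e f))) := by
  rw [← FStar.ker_mkQ_span_singleton]
  have g := LinearMap.quotKerEquivOfSurjective (FStar.mkQ S p e (Ideal.span {f}))
    (FStar.mkQ_surjective S p e _)
  exact ⟨g.symm⟩

theorem statement0 (p n b : ℕ) [Fact p.Prime]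
    (K : Type) [Field K] [CharP K p]
    (hKfin : Module.Finite K (FStar K p 1 K))
    (hb : Module.finrank K (FStar K p 1 K) = b)
    (S : Type) [CommRing S] [CharP S p]
    (hS : Nonempty (S ≃+* MvPolynomial (Fin n) K) ∨ Nonempty (S ≃+* MvPowerSeries (Fin n) K))
    (f : S) (hf0 : f ≠ 0) (hfu : ¬ IsUnit f) (e : ℕ) (he : 1 ≤ e) :
    (Module.Free S (FStar S p e S) ∧
      Module.finrank S (FStar S p e S) = b ^ e * (p ^ e) ^ n) ∧
    (∀ k : ℕ, 1 ≤ k → k ≤ p ^ e - 1 →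
      (mulMap S p e (f ^ k)).comp (mulMap S p e (f ^ (p ^ e - k))) =
        f • (LinearMap.id : FStar S p e S →ₗ[S] FStar S p e S)) ∧
    Nonempty ((FStar S p e (S ⧸ Ideal.span {f})) ≃ₗ[S]
      ((FStar S p e S) ⧸ LinearMap.range (mulMap S p e f))) := by
  refine ⟨?_, fun k _ hk ↦ mulMap_comp_mulMap f (by omega),
    FStar.nonempty_quotient_equiv S p e f⟩
  obtain ⟨ι, _, γ, hι, hγ⟩ :=
    (IsFrobBasis.of_basis (Module.finBasisOfFinrankEq K (FStar K p 1 K) hb)).exists_iterate e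
  obtain ⟨β, hβ⟩ : ∃ β : ι × (Fin n → Fin (p ^ e)) → S, IsFrobBasis (p ^ e) β := by
    obtain ⟨⟨φ⟩⟩ | ⟨⟨φ⟩⟩ := hS
    · exact ⟨_, (MvPolynomial.isFrobBasis_monomial hγ).map φ.symm⟩
    · exact ⟨_, (MvPowerSeries.isFrobBasis_monomial hγ).map φ.symm⟩
  have : Nontrivial S := ⟨f, 0, hf0⟩
  refine ⟨Module.Free.of_basis hβ.basis, ?_⟩
  rw [Module.finrank_eq_card_basis hβ.basis]
  simp [hι]
end

section
/- Let K be a field of prime characteristic p with [K:K^p] < ∞, let S be either K[x_1,…,x_n] or K[[x_1,…,x_n]], and let I be a monomial ideal of S, i.e. an ideal generated by finitely many monomials in x_1,…,x_n. Then the ring R = S/I has finite F-representation type. -/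
open scoped DirectSum

universe u v w

/-- Criterion for a quotient ring `S ⧸ I` to have finite F-representation type: for every `e`, there
are finitely many `p ^ e`-inverse-linear coordinates on `S`, which can be prescribed independently
and which cut out `I` by conditions from a fixed finite family of ideals. -/
theorem hasFFRT_quotient_of_coords {S : Type u} [CommRing S] (p : ℕ) (I : Ideal S)
    {Γ : Type v} [Finite Γ] (J : Γ → Ideal S) (hIJ : ∀ γ, I ≤ J γ)
    (h : ∀ e : ℕ, ∃ (ι : Type) (_ : Finite ι) (c : ι → Γ) (ψ : ι → S →+ S),
      (∀ i r f, ψ i (r ^ p ^ e * f) = r * ψ i f) ∧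
      (∀ r : ι → S, ∃ f, ∀ i, ψ i f = r i) ∧
      (∀ f, f ∈ I ↔ ∀ i, ψ i f ∈ J (c i))) :
    HasFFRT p (S ⧸ I) := by
  obtain ⟨s, ⟨eΓ⟩⟩ := Finite.exists_equiv_fin Γ
  let J' : Fin s → Ideal S := fun k => J (eΓ.symm k)
  refine ⟨s, fun k => ModuleCat.of (S ⧸ I) ((S ⧸ I) ⧸ (J' k).map (Ideal.Quotient.mk I)),
    fun k => inferInstanceAs (Module.Finite (S ⧸ I) ((S ⧸ I) ⧸ _)), fun e _ => ?_⟩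
  obtain ⟨ι, hι, c, ψ, hsmul, hsurj, hmem⟩ := h e
  have := Fintype.ofFinite ι
  classical
  let c' : ι → Fin s := fun i => eΓ (c i)
  let E : (Σ k, Fin (Fintype.card {i // c' i = k})) ≃ ι :=
    (Equiv.sigmaCongrRight fun k => (Fintype.equivFin {i // c' i = k}).symm).trans
      (Equiv.sigmaFiberEquiv c')
  have hE : ∀ x, c' (E x) = x.1 := fun x => ((Fintype.equivFin {i // c' i = x.1}).symm x.2).2
  have hmk : ∀ k x, DoubleQuot.quotQuotMk I (J' k) x = 0 ↔ x ∈ J' k := fun k x => by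
    rw [← RingHom.mem_ker, DoubleQuot.ker_quotQuotMk, sup_eq_right.2 (hIJ _)]
  let Ψ : S →+ ∀ k, Fin (Fintype.card {i // c' i = k}) →
      (S ⧸ I) ⧸ (J' k).map (Ideal.Quotient.mk I) :=
    AddMonoidHom.mk' (fun f k l => DoubleQuot.quotQuotMk I (J' k) (ψ (E ⟨k, l⟩) f))
      (fun f g => by ext k l; simp)
  have hker : ∀ f, Ψ f = 0 ↔ f ∈ I := by
    intro f
    rw [hmem, ← E.forall_congr_right, Sigma.forall, funext_iff]
    refine forall_congr' fun k => ?_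
    rw [funext_iff]
    refine forall_congr' fun l => (hmk k _).trans ?_
    have : eΓ (c (E ⟨k, l⟩)) = k := hE ⟨k, l⟩
    have : J' k = J (c (E ⟨k, l⟩)) := by
      simp only [J', ← eΓ.eq_symm_apply.2 this]
    rw [this]
  let Φ : S ⧸ I →+ ∀ k, Fin (Fintype.card {i // c' i = k}) →
      (S ⧸ I) ⧸ (J' k).map (Ideal.Quotient.mk I) :=
    QuotientAddGroup.lift I.toAddSubgroup Ψ fun f hf => (hker f).2 hf
  have hΦ : ∀ f, Φ (Ideal.Quotient.mk I f) = Ψ f := fun f => rfl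
  have hbij : Function.Bijective Φ := by
    constructor
    · rw [injective_iff_map_eq_zero]
      intro x
      obtain ⟨f, rfl⟩ := Ideal.Quotient.mk_surjective x
      rw [hΦ, hker, Ideal.Quotient.eq_zero_iff_mem]
      exact id
    · intro y
      have hq : ∀ k z, ∃ f, DoubleQuot.quotQuotMk I (J' k) f = z := fun k z => by
        obtain ⟨w, rfl⟩ := Ideal.Quotient.mk_surjective z
        obtain ⟨f, rfl⟩ := Ideal.Quotient.mk_surjective w
        exact ⟨f, rfl⟩
      choose r hr using hq
      obtain ⟨f, hf⟩ := hsurj fun i => r (E.symm i).1 (y (E.symm i).1 (E.symm i).2)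
      refine ⟨Ideal.Quotient.mk I f, ?_⟩
      rw [hΦ]
      ext k l
      change DoubleQuot.quotQuotMk I (J' k) (ψ (E ⟨k, l⟩) f) = _
      rw [hf, Equiv.symm_apply_apply, hr]
  let L := DirectSum.linearEquivFunOnFintype (S ⧸ I) (Fin s) fun k =>
    Fin (Fintype.card {i // c' i = k}) → (S ⧸ I) ⧸ (J' k).map (Ideal.Quotient.mk I)
  refine ⟨fun k => Fintype.card {i // c' i = k},
    (AddEquiv.ofBijective Φ hbij).trans L.symm.toAddEquiv, fun r m => ?_⟩
  obtain ⟨r, rfl⟩ := Ideal.Quotient.mk_surjective r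
  obtain ⟨m, rfl⟩ := Ideal.Quotient.mk_surjective m
  have key : Φ (Ideal.Quotient.mk I r ^ p ^ e • Ideal.Quotient.mk I m) =
      Ideal.Quotient.mk I r • Φ (Ideal.Quotient.mk I m) := by
    rw [smul_eq_mul, ← map_pow, ← map_mul, hΦ, hΦ]
    ext k l
    change DoubleQuot.quotQuotMk I (J' k) (ψ (E ⟨k, l⟩) (r ^ p ^ e * m)) = _
    rw [hsmul, map_mul]
    rfl
  exact (congrArg L.symm key).trans (map_smul L.symm _ _)

theorem finite_frobPow {K : Type u} [Field K] (p : ℕ) [Fact p.Prime] [CharP K p]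
    (hK : Module.Finite K (FStar K p 1 K)) (e : ℕ) : (frobPow K p e).Finite := by
  have : ExpChar K p := .prime Fact.out
  induction e with
  | zero =>
    have : frobPow K p 0 = RingHom.id K := by ext x; simp [frobPow]
    rw [this]
    exact RingHom.Finite.id K
  | succ e ih =>
    have h1 : (frobPow K p 1).Finite := hK
    have : frobPow K p (e + 1) = (frobPow K p 1).comp (frobPow K p e) := by
      ext x; simp [frobPow, iterateFrobenius_def, frobenius_def, pow_succ, pow_mul]
    rw [this]
    exact h1.comp ih

/-- A basis of `K` over `K ^ p ^ e`, with the `p ^ e`-th roots of the coordinates. -/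
theorem exists_frobenius_coords {K : Type u} [Field K] (p : ℕ) [Fact p.Prime] [CharP K p]
    (hK : Module.Finite K (FStar K p 1 K)) (e : ℕ) :
    ∃ (r : ℕ) (b : Fin r → K) (c : Fin r → K →+ K),
      (∀ i a x, c i (a ^ p ^ e * x) = a * c i x) ∧
      (∀ i j, c i (b j) = if i = j then 1 else 0) ∧
      (∀ x, (∀ i, c i x = 0) → x = 0) := by
  have : ExpChar K p := .prime Fact.out
  have : Module.Finite K (FStar K p e K) := finite_frobPow p hK e
  let B := Module.finBasis K (FStar K p e K)
  have hsmul : ∀ a x : K, a ^ p ^ e * x = (a • (show FStar K p e K from x) :) := fun a x => by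
    change _ = frobPow K p e a * x
    simp [frobPow, iterateFrobenius_def]
  refine ⟨_, fun i => B i, fun i => (B.coord i).toAddMonoidHom, fun i a x => ?_, fun i j => ?_,
    fun x hx => ?_⟩
  · rw [hsmul]
    exact map_smul (B.coord i) a _
  · change B.repr (B j) i = _
    rw [B.repr_self, Finsupp.single_apply]
    simp only [eq_comm]
  · exact B.forall_coord_eq_zero_iff.1 hx

open MvPowerSeries in
/-- The coefficients of `f` at exponents `≡ a` modulo `q`, transformed by `c`. -/
noncomputable def residueSeries {n : ℕ} {K : Type u} [Field K] (q : ℕ) (a : Fin n →₀ ℕ)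
    (c : K →+ K) : MvPowerSeries (Fin n) K →+ MvPowerSeries (Fin n) K :=
  AddMonoidHom.mk' (fun f b => c (coeff (q • b + a) f)) fun f g => by
    ext b
    change c _ = c _ + c _
    simp

open MvPowerSeries in
theorem coeff_residueSeries {n : ℕ} {K : Type u} [Field K] (q : ℕ) (a b : Fin n →₀ ℕ)
    (c : K →+ K) (f : MvPowerSeries (Fin n) K) :
    coeff b (residueSeries q a c f) = c (coeff (q • b + a) f) := rfl

open MvPowerSeries in
theorem residueSeries_pow_mul {n : ℕ} {K : Type u} [Field K] (p : ℕ) [Fact p.Prime] [CharP K p]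
    (e : ℕ) (a : Fin n →₀ ℕ) (ha : ∀ i, a i < p ^ e) (c : K →+ K)
    (hc : ∀ u x, c (u ^ p ^ e * x) = u * c x) (r f : MvPowerSeries (Fin n) K) :
    residueSeries (p ^ e) a c (r ^ p ^ e * f) = r * residueSeries (p ^ e) a c f := by
  classical
  have : ExpChar K p := .prime Fact.out
  have hp : p ≠ 0 := (Fact.out : p.Prime).ne_zero
  have hq : 0 < p ^ e := pow_pos (Nat.pos_of_ne_zero hp) e
  ext b
  rw [coeff_residueSeries, coeff_mul, coeff_mul, map_sum]
  symm
  refine Finset.sum_of_injOn (fun x => (p ^ e • x.1, p ^ e • x.2 + a)) ?_ ?_ ?_ ?_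
  · rintro ⟨u, v⟩ - ⟨u', v'⟩ - h
    simpa [nsmul_right_inj hq.ne'] using h
  · rintro ⟨u, v⟩ h
    simp only [Finset.mem_coe, Finset.HasAntidiagonal.mem_antidiagonal] at h ⊢
    rw [← h, smul_add, add_assoc]
  · rintro ⟨u, v⟩ huv hne
    rw [Finset.HasAntidiagonal.mem_antidiagonal] at huv
    by_cases hu : ∀ i, p ^ e ∣ u i
    · exfalso
      choose w hw using hu
      have hwb : ∀ i, w i ≤ b i := fun i => by
        have := DFunLike.congr_fun huv i
        simp only [Finsupp.add_apply, Finsupp.smul_apply, smul_eq_mul, hw] at this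
        have := ha i
        by_contra! hlt
        have := Nat.mul_le_mul_left (p ^ e) (Nat.succ_le_of_lt hlt)
        rw [Nat.mul_succ] at this
        omega
      refine hne ⟨(Finsupp.equivFunOnFinite.symm w, b - Finsupp.equivFunOnFinite.symm w), ?_, ?_⟩
      · rw [Finset.mem_coe, Finset.HasAntidiagonal.mem_antidiagonal]
        exact add_tsub_cancel_of_le fun i => hwb i
      · ext i
        · simp [hw]
        · have h1 := DFunLike.congr_fun huv i
          have h2 := Nat.mul_le_mul_left (p ^ e) (hwb i)
          simp only [Finsupp.add_apply, Finsupp.smul_apply, smul_eq_mul, hw,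
            Finsupp.tsub_apply, Finsupp.equivFunOnFinite_symm_apply_apply, Nat.mul_sub] at h1 ⊢
          omega
    · push Not at hu
      obtain ⟨i, hi⟩ := hu
      rw [← map_iterateFrobenius_expand p hp, coeff_map, coeff_expand_of_not_dvd _ _ _ hi]
      simp
  · rintro ⟨u, v⟩ -
    rw [← map_iterateFrobenius_expand p hp, coeff_map, coeff_expand_smul, iterateFrobenius_def, hc,
      coeff_residueSeries]

open MvPowerSeries in
theorem residueSeries_monomial {n : ℕ} {K : Type u} [Field K] (q : ℕ) (a a' : Fin n →₀ ℕ)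
    (ha' : ∀ i, a' i < q) (c : K →+ K) (x : K) :
    residueSeries q a c (monomial a' x) = if a = a' then C (c x) else 0 := by
  classical
  ext b
  rw [coeff_residueSeries, coeff_monomial]
  by_cases hb : b = 0
  · subst hb
    by_cases h : a = a' <;> simp [h]
  · obtain ⟨i, hi⟩ := DFunLike.ne_iff.1 hb
    have : q • b + a ≠ a' := fun h => by
      have h1 := DFunLike.congr_fun h i
      simp only [Finsupp.add_apply, Finsupp.smul_apply, smul_eq_mul] at h1
      have := Nat.le_mul_of_pos_right q (Nat.pos_of_ne_zero hi)
      have := ha' i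
      omega
    rw [if_neg this, map_zero]
    split_ifs <;> simp [coeff_C, hb]

open MvPowerSeries in
/-- Rings of power series that contain all monomials and are closed under `residueSeries` have
monomial quotients of finite F-representation type. -/
theorem hasFFRT_of_monomial_ideal {n t : ℕ} {K : Type u} [Field K] (p : ℕ) [Fact p.Prime]
    [CharP K p] (hK : Module.Finite K (FStar K p 1 K))
    {S : Type u} [CommRing S] (T : S →+* MvPowerSeries (Fin n) K) (hT : Function.Injective T)
    (hmono : ∀ a x, ∃ f, T f = monomial a x)
    (hres : ∀ q ≠ 0, ∀ a c f, ∃ g, T g = residueSeries q a c (T f))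
    (x : (Fin n → ℕ) → S)
    (hmem : ∀ (d : Fin t → Fin n → ℕ) (f : S), f ∈ Ideal.span (Set.range fun j => x (d j)) ↔
      ∀ m, coeff m (T f) ≠ 0 → ∃ j, ∀ i, d j i ≤ m i)
    (d : Fin t → Fin n → ℕ) :
    HasFFRT p (S ⧸ Ideal.span (Set.range fun j => x (d j))) := by
  refine hasFFRT_quotient_of_coords p _ (Γ := ∀ j i, Fin (d j i + 1))
    (fun γ => Ideal.span (Set.range fun j => x fun i => γ j i)) ?_ ?_
  · intro γ f
    rw [hmem, hmem]
    intro h m hm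
    obtain ⟨j, hj⟩ := h m hm
    exact ⟨j, fun i => (Nat.le_of_lt_succ (γ j i).2).trans (hj i)⟩
  intro e
  obtain ⟨r, b, c, hc, hcb, hc0⟩ := exists_frobenius_coords p hK e
  have hq : 0 < p ^ e := pow_pos (Fact.out : p.Prime).pos e
  choose ρ hρ using hres (p ^ e) hq.ne'
  choose mon hmon using hmono
  let A : (Fin n → Fin (p ^ e)) → Fin n →₀ ℕ := fun a => Finsupp.equivFunOnFinite.symm fun i => a i
  have hA : ∀ a i, A a i < p ^ e := fun a i => (a i).2
  have hAinj : ∀ a a', A a = A a' ↔ a = a' := fun a a' => by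
    refine ⟨fun h => ?_, fun h => h ▸ rfl⟩
    ext i
    exact DFunLike.congr_fun h i
  let ψ : Fin r × (Fin n → Fin (p ^ e)) → S →+ S := fun i =>
    AddMonoidHom.mk' (ρ (A i.2) (c i.1)) fun f g => hT (by simp [hρ])
  have hψ : ∀ i f, T (ψ i f) = residueSeries (p ^ e) (A i.2) (c i.1) (T f) := fun i f => hρ _ _ _
  have hψmul : ∀ i r f, ψ i (r ^ p ^ e * f) = r * ψ i f := fun i r f => hT (by
    rw [hψ, T.map_mul, T.map_mul, map_pow, hψ, residueSeries_pow_mul p e _ (hA _) _ (hc _)])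
  refine ⟨Fin r × (Fin n → Fin (p ^ e)), inferInstance, fun i j k =>
    ⟨(d j k - A i.2 k + (p ^ e - 1)) / p ^ e, ?_⟩, ψ, hψmul, ?_, ?_⟩
  · rw [Nat.div_lt_iff_lt_mul hq]
    have := Nat.mul_le_mul_left (d j k) hq
    rw [Nat.add_mul]
    omega
  · intro s
    refine ⟨∑ i, s i ^ p ^ e * mon (A i.2) (b i.1), fun i => ?_⟩
    rw [map_sum, Finset.sum_eq_single i]
    · rw [hψmul]
      refine hT ?_
      rw [map_mul, hψ, hmon, residueSeries_monomial _ _ _ (hA _), if_pos rfl, hcb, if_pos rfl]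
      simp
    · intro j _ hji
      rw [hψmul]
      refine hT ?_
      rw [map_mul, hψ, hmon, residueSeries_monomial _ _ _ (hA _), hcb]
      simp only [hAinj]
      by_cases h1 : i.1 = j.1
      · rw [if_neg fun h2 => hji (Prod.ext h1 h2).symm]
        simp
      · simp [h1]
    · simp
  · intro f
    have hle : ∀ (u v w : ℕ), (u - v + (p ^ e - 1)) / p ^ e ≤ w ↔ u ≤ p ^ e * w + v := by
      intro u v w
      rw [← Nat.lt_succ_iff, Nat.div_lt_iff_lt_mul hq, Nat.succ_mul, mul_comm w]
      omega
    simp only [hmem, hψ, coeff_residueSeries, hle]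
    constructor
    · intro h i m hm
      exact h _ fun h0 => hm (by rw [h0, map_zero])
    · intro h m hm
      obtain ⟨i, hi⟩ : ∃ i, c i (coeff m (T f)) ≠ 0 := by
        by_contra! hall
        exact hm (hc0 _ hall)
      let a : Fin n → Fin (p ^ e) := fun i => ⟨m i % p ^ e, Nat.mod_lt _ hq⟩
      let m' : Fin n →₀ ℕ := Finsupp.equivFunOnFinite.symm fun i => m i / p ^ e
      have hm' : p ^ e • m' + A a = m := by
        ext k
        exact Nat.div_add_mod (m k) (p ^ e)
      obtain ⟨j, hj⟩ := h (i, a) m' (by rwa [hm'])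
      refine ⟨j, fun k => (hj k).trans_eq ?_⟩
      exact Nat.div_add_mod (m k) (p ^ e)

theorem MvPolynomial.mem_span_prod_X_pow {n t : ℕ} {K : Type u} [Field K]
    (d : Fin t → Fin n → ℕ) (f : MvPolynomial (Fin n) K) :
    f ∈ Ideal.span (Set.range fun j => ∏ i, (X i : MvPolynomial (Fin n) K) ^ d j i) ↔
      ∀ m, coeff m f ≠ 0 → ∃ j, ∀ i, d j i ≤ m i := by
  have : (Set.range fun j => ∏ i, (X i : MvPolynomial (Fin n) K) ^ d j i) =
      (fun s => monomial s (1 : K)) ''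
        Set.range fun j => Finsupp.equivFunOnFinite.symm (d j) := by
    rw [← Set.range_comp]
    congr 1
    ext1 j
    rw [Function.comp_apply, monomial_eq, Finsupp.prod_fintype _ _ (by simp)]
    simp
  rw [this, mem_ideal_span_monomial_image]
  simp [Finsupp.le_def]

theorem MvPowerSeries.mem_span_prod_X_pow {n t : ℕ} {K : Type u} [Field K]
    (d : Fin t → Fin n → ℕ) (f : MvPowerSeries (Fin n) K) :
    f ∈ Ideal.span (Set.range fun j => ∏ i, (X i : MvPowerSeries (Fin n) K) ^ d j i) ↔
      ∀ m, coeff m f ≠ 0 → ∃ j, ∀ i, d j i ≤ m i := by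
  classical
  let D : Fin t → Fin n →₀ ℕ := fun j => Finsupp.equivFunOnFinite.symm (d j)
  have hD : ∀ j, ∏ i, (X i : MvPowerSeries (Fin n) K) ^ d j i = monomial (D j) 1 := fun j => by
    rw [monomial_one_eq, Finsupp.prod_fintype _ _ (by simp)]
    simp [D]
  simp only [hD]
  constructor
  · intro hf
    obtain ⟨g, rfl⟩ := (Ideal.mem_span_range_iff_exists_fun).1 hf
    intro m hm
    rw [map_sum] at hm
    obtain ⟨j, -, hj⟩ := Finset.exists_ne_zero_of_sum_ne_zero hm
    rw [coeff_mul_monomial] at hj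
    exact ⟨j, fun i => (ite_ne_right_iff.1 hj).1 i⟩
  · intro h
    by_cases hf : f = 0
    · rw [hf]
      exact zero_mem _
    obtain ⟨m₀, hm₀⟩ := (MvPowerSeries.ne_zero_iff_exists_coeff_ne_zero f).1 hf
    have : Nonempty (Fin t) := ⟨(h m₀ hm₀).choose⟩
    choose! J hJ using h
    obtain ⟨g, hg⟩ : ∃ g : Fin t → MvPowerSeries (Fin n) K, ∀ j m,
        coeff m (g j) = if J (m + D j) = j then coeff (m + D j) f else 0 :=
      ⟨fun j m => if J (m + D j) = j then coeff (m + D j) f else 0, fun _ _ => rfl⟩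
    have hgD : ∀ j m, D j ≤ m →
        coeff m (g j * monomial (D j) 1) = if J m = j then coeff m f else 0 := fun j m hle => by
      rw [coeff_mul_monomial, if_pos hle, mul_one, hg, tsub_add_cancel_of_le hle]
    have hgD' : ∀ j m, ¬ D j ≤ m → coeff m (g j * monomial (D j) 1) = 0 := fun j m hle => by
      rw [coeff_mul_monomial, if_neg hle]
    refine Ideal.mem_span_range_iff_exists_fun.2 ⟨g, ?_⟩
    ext m
    rw [map_sum, Finset.sum_eq_single (J m)]
    · by_cases hle : D (J m) ≤ m
      · rw [hgD _ _ hle, if_pos rfl]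
      · rw [hgD' _ _ hle]
        by_contra hm
        exact hle (hJ m (Ne.symm hm))
    · intro j _ hj
      by_cases hle : D j ≤ m
      · rw [hgD _ _ hle, if_neg hj.symm]
      · exact hgD' _ _ hle
    · simp

theorem exists_coe_eq_residueSeries {n : ℕ} {K : Type u} [Field K] {q : ℕ} (hq : q ≠ 0)
    (a : Fin n →₀ ℕ) (c : K →+ K) (f : MvPolynomial (Fin n) K) :
    ∃ g : MvPolynomial (Fin n) K, (g : MvPowerSeries (Fin n) K) = residueSeries q a c f := by
  classical
  have hinj : Function.Injective fun b : Fin n →₀ ℕ => q • b + a := fun b b' h => by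
    simpa [nsmul_right_inj hq] using h
  refine ⟨∑ b ∈ f.support.preimage _ hinj.injOn,
    MvPolynomial.monomial b (c (f.coeff (q • b + a))), ?_⟩
  ext b
  rw [MvPolynomial.coeff_coe, MvPolynomial.coeff_sum, coeff_residueSeries, MvPolynomial.coeff_coe]
  simp only [MvPolynomial.coeff_monomial, Finset.sum_ite_eq', Finset.mem_preimage,
    MvPolynomial.mem_support_iff]
  split_ifs with h
  · rfl
  · rw [not_not.1 h, map_zero]

theorem statement2 (p n t : ℕ) [Fact p.Prime]
    (K : Type) [Field K] [CharP K p]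
    -- `[K : Kᵖ] < ∞`, i.e. `K` is finitely generated as a module over `Kᵖ`
    (hKfin : Module.Finite K (FStar K p 1 K))
    -- the exponents of the `t` monomial generators of the monomial ideal `I`
    (d : Fin t → Fin n → ℕ) :
    -- both for `S = K[x₁,…,xₙ]` …
    HasFFRT p (MvPolynomial (Fin n) K ⧸
      Ideal.span (Set.range fun j =>
        ∏ i, (MvPolynomial.X i : MvPolynomial (Fin n) K) ^ d j i)) ∧
    -- … and for `S = K⟦x₁,…,xₙ⟧`, the ring `S/I` has finite F-representation type
    HasFFRT p (MvPowerSeries (Fin n) K ⧸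
      Ideal.span (Set.range fun j =>
        ∏ i, (MvPowerSeries.X i : MvPowerSeries (Fin n) K) ^ d j i)) := by
  exact ⟨
    hasFFRT_of_monomial_ideal p hKfin MvPolynomial.coeToMvPowerSeries.ringHom
      (MvPolynomial.coe_injective _ _)
      (fun a x => ⟨MvPolynomial.monomial a x, MvPolynomial.coe_monomial a x⟩)
      (fun _ hq a c f => exists_coe_eq_residueSeries hq a c f)
      (fun d => ∏ i, MvPolynomial.X i ^ d i)
      (fun d f => by
        simpa [MvPolynomial.coeff_coe] using MvPolynomial.mem_span_prod_X_pow d f) d,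
    hasFFRT_of_monomial_ideal p hKfin (RingHom.id _) Function.injective_id
      (fun a x => ⟨_, rfl⟩) (fun _ _ _ _ _ => ⟨_, rfl⟩)
      (fun d => ∏ i, MvPowerSeries.X i ^ d i) MvPowerSeries.mem_span_prod_X_pow d⟩
end

section
/- Let R be a Noetherian commutative ring of prime characteristic p that has finite F-representation type. Then for every m ≥ 1, the polynomial ring R[x_1,…,x_m] has finite F-representation type and the power series ring R[[x_1,…,x_m]] has finite F-representation type. -/
open scoped DirectSum

universe u v w

/-- The additive group `M⟦x⟧` of formal power series with coefficients in `M` and variables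
indexed by `σ`; it is a module over the power series ring `R⟦x⟧` whenever `M` is an
`R`-module. -/
def SeriesModule (σ : Type*) (M : Type*) : Type _ := (σ →₀ ℕ) → M

namespace SeriesModule

open Finset

@[ext]
theorem ext {σ M : Type*} {v w : SeriesModule σ M} (h : ∀ d, v d = w d) : v = w := funext h

variable {σ : Type*} {R : Type*} {M : Type*} [CommRing R] [AddCommGroup M] [Module R M]

instance : AddCommGroup (SeriesModule σ M) :=
  inferInstanceAs (AddCommGroup ((σ →₀ ℕ) → M))

@[simp]
theorem add_apply (v w : SeriesModule σ M) (d : σ →₀ ℕ) : (v + w) d = v d + w d := rfl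

@[simp]
theorem zero_apply (d : σ →₀ ℕ) : (0 : SeriesModule σ M) d = 0 := rfl

theorem sum_apply {ι : Type*} (s : Finset ι) (v : ι → SeriesModule σ M) (d : σ →₀ ℕ) :
    (∑ i ∈ s, v i) d = ∑ i ∈ s, v i d :=
  Finset.sum_apply d s v

open Classical in
noncomputable instance : SMul (MvPowerSeries σ R) (SeriesModule σ M) where
  smul f v := fun d => ∑ a ∈ antidiagonal d, MvPowerSeries.coeff a.1 f • v a.2

theorem smul_apply [DecidableEq σ] (f : MvPowerSeries σ R) (v : SeriesModule σ M) (d : σ →₀ ℕ) :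
    (f • v) d = ∑ a ∈ antidiagonal d, MvPowerSeries.coeff a.1 f • v a.2 := by
  change Finset.sum _ _ = _
  congr!

noncomputable instance : Module (MvPowerSeries σ R) (SeriesModule σ M) where
  one_smul v := by
    classical
    ext d
    rw [smul_apply, Finset.sum_eq_single (0, d)]
    · simp
    · rintro ⟨a, b⟩ hab hne
      rw [MvPowerSeries.coeff_one, if_neg, zero_smul]
      rintro rfl
      simp_all
    · simp
  mul_smul f g v := by
    classical
    ext d
    simp only [smul_apply, MvPowerSeries.coeff_mul, Finset.sum_smul, Finset.smul_sum,
      Finset.sum_sigma']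
    apply Finset.sum_nbij' (fun ⟨⟨_i, j⟩, ⟨k, l⟩⟩ ↦ ⟨(k, l + j), (l, j)⟩)
      (fun ⟨⟨i, _j⟩, ⟨k, l⟩⟩ ↦ ⟨(i + k, l), (i, k)⟩) <;>
      simp +contextual [mul_smul] <;> grind
  smul_zero f := by
    classical
    ext d
    simp [smul_apply]
  smul_add f v w := by
    classical
    ext d
    simp [smul_apply, Finset.sum_add_distrib]
  add_smul f g v := by
    classical
    ext d
    simp [smul_apply, add_smul, Finset.sum_add_distrib]
  zero_smul v := by
    classical
    ext d
    simp [smul_apply]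

open Classical in
/-- The constant series with value `m`. -/
noncomputable def const (m : M) : SeriesModule σ M := Pi.single 0 m

theorem smul_const_apply (f : MvPowerSeries σ R) (m : M) (d : σ →₀ ℕ) :
    (f • (const m : SeriesModule σ M)) d = MvPowerSeries.coeff d f • m := by
  classical
  rw [smul_apply, Finset.sum_eq_single (d, 0)]
  · simp [const]
  · rintro ⟨a, b⟩ hab hne
    have hb : b ≠ 0 := by
      rintro rfl
      simp_all
    simp [const, hb]
  · simp

instance [Module.Finite R M] : Module.Finite (MvPowerSeries σ R) (SeriesModule σ M) := by
  obtain ⟨n, s, hs⟩ := Module.Finite.exists_fin (R := R) (M := M)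
  refine Module.Finite.of_surjective
    (Fintype.linearCombination (MvPowerSeries σ R) fun i => (const (s i) : SeriesModule σ M)) ?_
  intro v
  have hv : ∀ d, ∃ c : Fin n → R, ∑ i, c i • s i = v d := fun d =>
    (Submodule.mem_span_range_iff_exists_fun R).1 (hs ▸ Submodule.mem_top)
  choose c hc using hv
  let f (i : Fin n) : MvPowerSeries σ R := fun d => c d i
  refine ⟨f, SeriesModule.ext fun d => ?_⟩
  rw [Fintype.linearCombination_apply, sum_apply, ← hc d]
  exact Finset.sum_congr rfl fun i _ => smul_const_apply _ _ _

noncomputable instance : Module (MvPolynomial σ R) (SeriesModule σ M) :=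
  Module.compHom _ (MvPolynomial.coeToMvPowerSeries.ringHom (σ := σ) (R := R))

theorem polynomial_smul_def (f : MvPolynomial σ R) (v : SeriesModule σ M) :
    f • v = (f : MvPowerSeries σ R) • v := rfl

variable (σ R M) in
/-- The `R[x]`-submodule `M[x]` of `M⟦x⟧` of polynomials with coefficients in `M`. -/
noncomputable def polynomials : Submodule (MvPolynomial σ R) (SeriesModule σ M) where
  carrier := {v | {d | v d ≠ 0}.Finite}
  zero_mem' := by simp
  add_mem' {v w} hv hw := (hv.union hw).subset fun d hd => by
    by_contra h
    simp_all
  smul_mem' f v hv := by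
    classical
    refine ((f.support.finite_toSet.prod hv).image fun a => a.1 + a.2).subset ?_
    intro d hd
    rw [Set.mem_ofPred_eq, polynomial_smul_def, smul_apply] at hd
    obtain ⟨a, ha, hne⟩ := Finset.exists_ne_zero_of_sum_ne_zero hd
    rw [MvPolynomial.coeff_coe] at hne
    refine ⟨a, ⟨?_, ?_⟩, by simpa using ha⟩
    · simpa using left_ne_zero_of_smul hne
    · exact right_ne_zero_of_smul hne

theorem mem_polynomials {v : SeriesModule σ M} :
    v ∈ polynomials σ R M ↔ {d | v d ≠ 0}.Finite := Iff.rfl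

theorem const_mem_polynomials (m : M) : const m ∈ polynomials σ R M := by
  classical
  refine (Set.finite_singleton 0).subset fun d hd => ?_
  by_contra h
  exact hd (Pi.single_eq_of_ne (M := fun _ => M) h m)

instance [Module.Finite R M] : Module.Finite (MvPolynomial σ R) (polynomials σ R M) := by
  classical
  obtain ⟨n, s, hs⟩ := Module.Finite.exists_fin (R := R) (M := M)
  refine Module.Finite.of_surjective
    (Fintype.linearCombination (MvPolynomial σ R) fun i =>
      (⟨const (s i), const_mem_polynomials (s i)⟩ : polynomials σ R M)) ?_
  rintro ⟨v, hv⟩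
  have hc : ∀ d, ∃ c : Fin n → R, ∑ i, c i • s i = v d := fun d =>
    (Submodule.mem_span_range_iff_exists_fun R).1 (hs ▸ Submodule.mem_top)
  choose c hc using hc
  rw [mem_polynomials] at hv
  refine ⟨fun i => ∑ d ∈ hv.toFinset, MvPolynomial.monomial d (c d i), ?_⟩
  apply Subtype.ext
  ext d
  simp only [Fintype.linearCombination_apply, Submodule.coe_sum, Submodule.coe_smul,
    polynomial_smul_def, sum_apply, smul_const_apply, MvPolynomial.coeff_coe,
    MvPolynomial.coeff_sum, MvPolynomial.coeff_monomial, Finset.sum_ite_eq']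
  by_cases hd : v d = 0
  · simp [hd]
  · simpa [hd] using hc d

end SeriesModule

section DivMod

variable {σ : Type*} [Finite σ] (q : ℕ) [NeZero q]

/-- Division with remainder by `q` of exponent vectors: `d = q • a + b` corresponds to
`(a, b)`. -/
noncomputable def Finsupp.divModEquiv : (σ →₀ ℕ) ≃ (σ →₀ ℕ) × (σ → Fin q) :=
  Finsupp.equivFunOnFinite.trans <|
    ((Equiv.arrowCongr (Equiv.refl σ) (Nat.divModEquiv q)).trans
      (Equiv.arrowProdEquivProdArrow _ _ _)).trans
        (Equiv.prodCongr Finsupp.equivFunOnFinite.symm (Equiv.refl _))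

theorem Finsupp.divModEquiv_symm_apply (a : σ →₀ ℕ) (b : σ → Fin q) (i : σ) :
    (Finsupp.divModEquiv q).symm (a, b) i = a i * q + b i := rfl

open Finset in
theorem MvPowerSeries.coeff_pow_mul [DecidableEq σ] {p : ℕ} [Fact p.Prime] {R : Type*}
    [CommRing R] [CharP R p] (e : ℕ) [NeZero (p ^ e)] (r f : MvPowerSeries σ R) (a : σ →₀ ℕ)
    (b : σ → Fin (p ^ e)) :
    coeff ((Finsupp.divModEquiv (p ^ e)).symm (a, b)) (r ^ p ^ e * f) =
      ∑ c ∈ antidiagonal a,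
        coeff c.1 r ^ p ^ e * coeff ((Finsupp.divModEquiv (p ^ e)).symm (c.2, b)) f := by
  have : ExpChar R p := .prime Fact.out
  have hq : p ^ e ≠ 0 := NeZero.ne _
  have hr := MvPowerSeries.map_iterateFrobenius_expand p (NeZero.ne p) r e
  rw [coeff_mul]
  symm
  refine Finset.sum_of_injOn
    (fun c => (p ^ e • c.1, (Finsupp.divModEquiv (p ^ e)).symm (c.2, b))) ?_ ?_ ?_ ?_
  · rintro ⟨c, d⟩ - ⟨c', d'⟩ - h
    simp only [Prod.mk.injEq, EmbeddingLike.apply_eq_iff_eq, and_true] at h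
    obtain ⟨h, rfl⟩ := h
    simp only [Prod.mk.injEq, and_true]
    ext i
    exact Nat.eq_of_mul_eq_mul_left (Nat.pos_of_ne_zero hq) (DFunLike.congr_fun h i)
  · rintro ⟨c, d⟩ h
    simp only [SetLike.mem_coe, HasAntidiagonal.mem_antidiagonal] at h ⊢
    subst h
    ext i
    simp only [Finsupp.add_apply, Finsupp.smul_apply, smul_eq_mul,
      Finsupp.divModEquiv_symm_apply]
    ring
  · rintro ⟨u, v⟩ huv hne
    rw [HasAntidiagonal.mem_antidiagonal] at huv
    dsimp only at huv ⊢
    rw [← hr, coeff_map]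
    by_cases hdvd : ∀ i, p ^ e ∣ u i
    · exfalso
      apply hne
      have huv' : ∀ i, u i + v i = a i * p ^ e + b i := fun i => DFunLike.congr_fun huv i
      choose c hc using hdvd
      have hle : ∀ i, c i ≤ a i := fun i => by
        have h1 := huv' i
        have h2 := (b i).isLt
        rw [hc] at h1
        refine Nat.le_of_lt_succ (Nat.lt_of_mul_lt_mul_left (a := p ^ e) ?_)
        rw [Nat.mul_succ, mul_comm _ (a i)]
        omega
      refine ⟨(Finsupp.equivFunOnFinite.symm c, a - Finsupp.equivFunOnFinite.symm c), ?_, ?_⟩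
      · simp only [SetLike.mem_coe, HasAntidiagonal.mem_antidiagonal]
        exact add_tsub_cancel_of_le hle
      · simp only [Prod.mk.injEq]
        refine ⟨?_, ?_⟩
        · ext i
          exact (hc i).symm
        · ext i
          have h1 := huv' i
          obtain ⟨k, hk⟩ := Nat.exists_eq_add_of_le (hle i)
          rw [Finsupp.divModEquiv_symm_apply]
          simp only [Finsupp.coe_tsub, Pi.sub_apply, Finsupp.equivFunOnFinite_symm_apply_apply]
          rw [hc, hk] at h1
          rw [hk, Nat.add_sub_cancel_left]
          linarith
    · push Not at hdvd
      obtain ⟨i, hi⟩ := hdvd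
      rw [coeff_expand_of_not_dvd _ _ _ hi, map_zero, zero_mul]
  · rintro ⟨c, d⟩ -
    dsimp only
    rw [← hr, coeff_map, coeff_expand_smul, iterateFrobenius_def]

end DivMod

section FrobIso

theorem FrobIso.trans_linearEquiv {R M N N' : Type*} [CommSemiring R] {q : ℕ} [AddCommMonoid M]
    [Module R M] [AddCommMonoid N] [Module R N] [AddCommMonoid N'] [Module R N']
    (h : FrobIso R q M N) (φ : N ≃ₗ[R] N') : FrobIso R q M N' := by
  obtain ⟨g, hg⟩ := h
  exact ⟨g.trans φ.toAddEquiv, fun r m => by simp [hg]⟩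

theorem HasFFRT.of_fintype {p : ℕ} {R : Type u} [CommRing R] {s : ℕ}
    (M : Fin s → ModuleCat.{u} R) [∀ i, Module.Finite R (M i)]
    (h : ∀ e : ℕ, 1 ≤ e → ∃ κ : Fin s → Type, ∃ _ : ∀ i, Fintype (κ i),
      FrobIso R (p ^ e) R (∀ i, κ i → M i)) : HasFFRT p R := by
  refine ⟨s, M, inferInstance, fun e he => ?_⟩
  obtain ⟨κ, _, hκ⟩ := h e he
  refine ⟨fun i => Fintype.card (κ i), hκ.trans_linearEquiv ?_⟩
  exact (LinearEquiv.piCongrRight fun i =>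
    LinearEquiv.funCongrLeft R (M i) (Fintype.equivFin (κ i)).symm).trans
      (DirectSum.linearEquivFunOnFintype R (Fin s) _).symm

variable {σ : Type*} [Finite σ] {R : Type*} [CommRing R] {ι : Type*} {κ : ι → Type*}
  {M : ι → Type*} [∀ i, AddCommGroup (M i)]

/-- The additive isomorphism decomposing a power series according to the residues modulo `q` of
its exponents, and then decomposing its coefficients along `g`. -/
noncomputable def MvPowerSeries.decompose (q : ℕ) [NeZero q] (g : R ≃+ ∀ i, κ i → M i) :
    MvPowerSeries σ R ≃+ ∀ i, (σ → Fin q) × κ i → SeriesModule σ (M i) where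
  toFun f i k a := g (coeff ((Finsupp.divModEquiv q).symm (a, k.1)) f) i k.2
  invFun v d := g.symm fun i k =>
    v i ((Finsupp.divModEquiv q d).2, k) (Finsupp.divModEquiv q d).1
  left_inv f := by
    ext d
    change g.symm (g (coeff ((Finsupp.divModEquiv q).symm (Finsupp.divModEquiv q d)) f)) = _
    simp
  right_inv v := by
    funext i k
    ext a
    change g (g.symm _) i k.2 = _
    simp
  map_add' f f' := by
    funext i k
    ext a
    change g (coeff _ (f + f')) i k.2 = g (coeff _ f) i k.2 + g (coeff _ f') i k.2
    simp

theorem MvPowerSeries.decompose_apply (q : ℕ) [NeZero q] (g : R ≃+ ∀ i, κ i → M i)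
    (f : MvPowerSeries σ R) (i : ι) (k : (σ → Fin q) × κ i) (a : σ →₀ ℕ) :
    decompose q g f i k a = g (coeff ((Finsupp.divModEquiv q).symm (a, k.1)) f) i k.2 := rfl

variable [∀ i, Module R (M i)]

theorem MvPowerSeries.decompose_pow_mul {p : ℕ} [Fact p.Prime] [CharP R p] (e : ℕ)
    [NeZero (p ^ e)] (g : R ≃+ ∀ i, κ i → M i) (hg : ∀ r x : R, g (r ^ p ^ e • x) = r • g x)
    (r f : MvPowerSeries σ R) :
    decompose (p ^ e) g (r ^ p ^ e * f) = r • decompose (p ^ e) g f := by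
  classical
  funext i k
  ext a
  rw [decompose_apply, coeff_pow_mul]
  simp only [decompose_apply, map_sum, Pi.smul_apply, SeriesModule.smul_apply,
    Finset.sum_apply, ← smul_eq_mul, hg]

theorem MvPowerSeries.frobIso {p : ℕ} [Fact p.Prime] [CharP R p] (e : ℕ) [NeZero (p ^ e)]
    (h : FrobIso R (p ^ e) R (∀ i, κ i → M i)) :
    FrobIso (MvPowerSeries σ R) (p ^ e) (MvPowerSeries σ R)
      (∀ i, (σ → Fin (p ^ e)) × κ i → SeriesModule σ (M i)) := by
  obtain ⟨g, hg⟩ := h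
  exact ⟨decompose (p ^ e) g, decompose_pow_mul e g hg⟩

theorem MvPowerSeries.decompose_mem_polynomials (q : ℕ) [NeZero q] (g : R ≃+ ∀ i, κ i → M i)
    (f : MvPolynomial σ R) (i : ι) (k : (σ → Fin q) × κ i) :
    decompose q g (f : MvPowerSeries σ R) i k ∈ SeriesModule.polynomials σ R (M i) := by
  rw [SeriesModule.mem_polynomials]
  refine (f.support.finite_toSet.image fun d => (Finsupp.divModEquiv q d).1).subset fun a ha => ?_
  refine ⟨(Finsupp.divModEquiv q).symm (a, k.1), ?_, by simp⟩
  simp only [SetLike.mem_coe, MvPolynomial.mem_support_iff]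
  intro h
  apply ha
  rw [decompose_apply, MvPolynomial.coeff_coe, h, map_zero]
  rfl

theorem MvPowerSeries.exists_polynomial_of_decompose [Finite ι] [∀ i, Finite (κ i)] (q : ℕ)
    [NeZero q] (g : R ≃+ ∀ i, κ i → M i) (f : MvPowerSeries σ R)
    (hf : ∀ i k, decompose q g f i k ∈ SeriesModule.polynomials σ R (M i)) :
    ∃ f' : MvPolynomial σ R, (f' : MvPowerSeries σ R) = f := by
  have hfin : (Function.support f).Finite := by
    refine ((Set.finite_iUnion fun i => Set.finite_iUnion fun k =>
      ((hf i k).prod (Set.finite_singleton k.1)).image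
        (Finsupp.divModEquiv q).symm)).subset fun d hd => ?_
    obtain ⟨⟨a, b⟩, rfl⟩ := (Finsupp.divModEquiv q).symm.surjective d
    have hne : g (coeff ((Finsupp.divModEquiv q).symm (a, b)) f) ≠ 0 := by
      rwa [Ne, map_eq_zero_iff g g.injective]
    obtain ⟨i, hi⟩ := Function.ne_iff.1 hne
    obtain ⟨j, hj⟩ := Function.ne_iff.1 hi
    simp only [Set.mem_iUnion]
    exact ⟨i, (b, j), (a, b), ⟨hj, rfl⟩, rfl⟩
  refine ⟨∑ d ∈ hfin.toFinset, MvPolynomial.monomial d (coeff d f), ?_⟩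
  classical
  ext d
  rw [MvPolynomial.coeff_coe, MvPolynomial.coeff_sum]
  simp only [MvPolynomial.coeff_monomial, Finset.sum_ite_eq', Set.Finite.mem_toFinset,
    ite_eq_left_iff]
  intro hd
  exact (Function.notMem_support.1 hd).symm

theorem MvPolynomial.frobIso [Finite ι] [∀ i, Finite (κ i)] {p : ℕ} [Fact p.Prime] [CharP R p]
    (e : ℕ) [NeZero (p ^ e)] (h : FrobIso R (p ^ e) R (∀ i, κ i → M i)) :
    FrobIso (MvPolynomial σ R) (p ^ e) (MvPolynomial σ R)
      (∀ i, (σ → Fin (p ^ e)) × κ i → SeriesModule.polynomials σ R (M i)) := by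
  obtain ⟨g, hg⟩ := h
  let φ : MvPolynomial σ R →+
      ∀ i, (σ → Fin (p ^ e)) × κ i → SeriesModule.polynomials σ R (M i) :=
    { toFun f i k := ⟨_, MvPowerSeries.decompose_mem_polynomials (p ^ e) g f i k⟩
      map_zero' := by
        ext i k
        simp
      map_add' f f' := by
        ext i k
        simp }
  have hφ : ∀ f i k, (φ f i k : SeriesModule σ (M i)) =
      MvPowerSeries.decompose (p ^ e) g (f : MvPowerSeries σ R) i k := fun _ _ _ => rfl
  have hbij : Function.Bijective φ := by
    constructor
    · intro f f' hff
      apply MvPolynomial.coe_injective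
      apply (MvPowerSeries.decompose (p ^ e) g).injective
      funext i k
      rw [← hφ, ← hφ, hff]
    · intro v
      obtain ⟨f, hf⟩ := (MvPowerSeries.decompose (σ := σ) (p ^ e) g).surjective
        fun i k => (v i k : SeriesModule σ (M i))
      obtain ⟨f', rfl⟩ := MvPowerSeries.exists_polynomial_of_decompose (p ^ e) g f
        fun i k => by
          rw [hf]
          exact (v i k).2
      refine ⟨f', ?_⟩
      funext i k
      apply Subtype.ext
      rw [hφ, hf]
  refine ⟨AddEquiv.ofBijective φ hbij, fun r f => ?_⟩
  funext i k
  apply Subtype.ext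
  change MvPowerSeries.decompose (p ^ e) g ((r ^ p ^ e * f : MvPolynomial σ R) :
    MvPowerSeries σ R) i k = _
  rw [MvPolynomial.coe_mul, MvPolynomial.coe_pow, MvPowerSeries.decompose_pow_mul e g hg]
  rfl

end FrobIso

theorem statement4 (p : ℕ) [Fact p.Prime] (R : Type u) [CommRing R] [IsNoetherianRing R]
    [CharP R p] (hR : HasFFRT p R) (m : ℕ) (hm : 1 ≤ m) :
    HasFFRT p (MvPolynomial (Fin m) R) ∧ HasFFRT p (MvPowerSeries (Fin m) R) := by
  obtain ⟨s, M, hM, h⟩ := hR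
  have hiso : ∀ e : ℕ, 1 ≤ e → ∃ t : Fin s → ℕ,
      FrobIso R (p ^ e) R (∀ i, Fin (t i) → M i) := fun e he => by
    obtain ⟨t, ht⟩ := h e he
    exact ⟨t, ht.trans_linearEquiv (DirectSum.linearEquivFunOnFintype R (Fin s) _)⟩
  have hq : ∀ e, NeZero (p ^ e) := fun e => ⟨pow_ne_zero e (Fact.out : p.Prime).ne_zero⟩
  constructor
  · refine HasFFRT.of_fintype
      (fun i => ModuleCat.of _ (SeriesModule.polynomials (Fin m) R (M i))) fun e he => ?_
    obtain ⟨t, ht⟩ := hiso e he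
    exact ⟨fun i => (Fin m → Fin (p ^ e)) × Fin (t i), fun i => inferInstance,
      MvPolynomial.frobIso e ht⟩
  · refine HasFFRT.of_fintype
      (fun i => ModuleCat.of (MvPowerSeries (Fin m) R) (SeriesModule (Fin m) (M i)))
        fun e he => ?_
    obtain ⟨t, ht⟩ := hiso e he
    exact ⟨fun i => (Fin m → Fin (p ^ e)) × Fin (t i), fun i => inferInstance,
      MvPowerSeries.frobIso e ht⟩
end

section
/- Let (R,m) be a Noetherian local ring of prime characteristic p and let M be a finitely generated R-module. If M has finite F-representation type, then M has finite F-representation type by an FFRT system: there exists a finite set {M_1,…,M_s} of finitely generated R-modules such that (i) for every e ≥ 1, F_*^e(M) is isomorphic to a finite direct sum of copies of M_1,…,M_s, and (ii) for every 1 ≤ j ≤ s, F_*^1(M_j) is isomorphic to a finite direct sum of copies of M_1,…,M_s. -/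
open scoped DirectSum

universe u v w

lemma Module.eq_top_of_sup_jacobson {E P : Type*} [Ring E] [AddCommGroup P] [Module E P]
    [Module.Finite E P] {N : Submodule E P} (h : N ⊔ Module.jacobson E P = ⊤) : N = ⊤ := by
  by_contra hN
  obtain ⟨K, hK, hNK⟩ := (eq_top_or_exists_le_coatom N).resolve_left hN
  exact hK.1 (top_le_iff.1 (h ▸ sup_le hNK (sInf_le hK)))

section FiniteAlgebra

open IsLocalRing

lemma isArtinian_of_isTorsionBySet_maximalIdeal {R Q : Type*} [CommRing R] [IsLocalRing R]
    [AddCommGroup Q] [Module R Q] [Module.Finite R Q]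
    (h : Module.IsTorsionBySet R Q (maximalIdeal R)) : IsArtinian R Q := by
  let := h.module
  let : Field (R ⧸ maximalIdeal R) := Ideal.Quotient.field _
  have : IsScalarTower R (R ⧸ maximalIdeal R) Q := h.isScalarTower
  have : Module.Finite (R ⧸ maximalIdeal R) Q := .of_restrictScalars_finite R _ _
  have : IsArtinian (R ⧸ maximalIdeal R) Q := inferInstance
  exact (isArtinian_of_surjective_algebraMap (R := R ⧸ maximalIdeal R) (S := R) (M := Q)
    Ideal.Quotient.mk_surjective)

variable {R E P : Type*} [CommRing R] [IsLocalRing R] [Ring E] [Algebra R E]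
  [AddCommGroup P] [Module R P] [Module E P] [IsScalarTower R E P] [Module.Finite R P]

lemma smul_mem_jacobson_of_mem_maximalIdeal {r : R} (hr : r ∈ maximalIdeal R) (x : P) :
    r • x ∈ Module.jacobson E P := by
  rw [Module.jacobson, Submodule.mem_sInf]
  intro N hN
  by_contra hx
  have : SMulCommClass R E P := IsScalarTower.to_smulCommClass
  let f : P →ₗ[E] P := DistribSMul.toLinearMap E P r
  have htop : N ⊔ LinearMap.range f = ⊤ :=
    hN.2 _ (left_lt_sup.2 fun hle => hx (hle ⟨x, rfl⟩))
  have hle : (⊤ : Submodule R P) ≤ N.restrictScalars R ⊔ maximalIdeal R • ⊤ := fun y _ => by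
    obtain ⟨n, hn, -, ⟨z, rfl⟩, rfl⟩ := Submodule.mem_sup.1 (htop.ge (Submodule.mem_top (x := y)))
    exact Submodule.add_mem_sup hn (Submodule.smul_mem_smul hr Submodule.mem_top)
  exact hx (Submodule.le_of_le_smul_of_le_jacobson_bot Module.Finite.fg_top
    (maximalIdeal_le_jacobson ⊥) hle Submodule.mem_top)

lemma isSemisimpleModule_quotient_jacobson (R E P : Type*) [CommRing R] [IsLocalRing R] [Ring E]
    [Algebra R E] [AddCommGroup P] [Module R P] [Module E P] [IsScalarTower R E P]
    [Module.Finite R P] :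
    IsSemisimpleModule E (P ⧸ Module.jacobson E P) := by
  have : Module.Finite R (P ⧸ Module.jacobson E P) :=
    Module.Finite.quotient R _
  have htors : Module.IsTorsionBySet R (P ⧸ Module.jacobson E P) (maximalIdeal R) := by
    rintro y ⟨r, hr⟩
    obtain ⟨x, rfl⟩ := (Module.jacobson E P).mkQ_surjective y
    have h : r • x ∈ Module.jacobson E P := smul_mem_jacobson_of_mem_maximalIdeal hr x
    generalize Module.jacobson E P = N at *
    exact (Submodule.Quotient.mk_eq_zero N).2 h
  have : IsArtinian R (P ⧸ Module.jacobson E P) :=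
    isArtinian_of_isTorsionBySet_maximalIdeal htors
  have : IsArtinian E (P ⧸ Module.jacobson E P) := isArtinian_of_tower R inferInstance
  exact (IsArtinian.isSemisimpleModule_iff_jacobson _ _).2 (Module.jacobson_quotient_jacobson _ _)

end FiniteAlgebra

/-- Collecting equal factors in a finite product of modules. -/
lemma exists_linearEquiv_pi_pow {E : Type*} [Semiring E] {n k : ℕ} (S : Fin k → Type*)
    [∀ i, AddCommMonoid (S i)] [∀ i, Module E (S i)] (σ : Fin n → Fin k) :
    ∃ t : Fin k → ℕ, Nonempty ((∀ j, S (σ j)) ≃ₗ[E] ∀ i, Fin (t i) → S i) := by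
  classical
  refine ⟨fun i => Fintype.card {j // σ j = i}, ⟨?_⟩⟩
  let e : (Σ i, Fin (Fintype.card {j // σ j = i})) ≃ Fin n :=
    (Equiv.sigmaCongrRight fun i => (Fintype.equivFin _).symm).trans (Equiv.sigmaFiberEquiv σ)
  have he : ∀ x, σ (e x) = x.1 := fun x => ((Fintype.equivFin {j // σ j = x.1}).symm x.2).2
  exact (LinearEquiv.piCongrLeft E (fun j => S (σ j)) e).symm ≪≫ₗ
    LinearEquiv.piCongrRight (fun x => LinearEquiv.cast (R := E) (M := S) (he x)) ≪≫ₗ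
    LinearEquiv.piCurry E fun i _ => S i

/-- A ring whose quotient by its Jacobson radical is semisimple has, up to isomorphism, only
finitely many simple modules. -/
lemma exists_finite_simple_modules {E : Type u} [Ring E]
    (hE : IsSemisimpleModule E (E ⧸ Module.jacobson E E)) :
    ∃ (k : ℕ) (S : Fin k → Submodule E (E ⧸ Module.jacobson E E)),
      ∀ (T : Type v) [AddCommGroup T] [Module E T] [IsSimpleModule E T],
        ∃ i, Nonempty (T ≃ₗ[E] S i) := by
  obtain ⟨k, S, e, hS⟩ :=
    IsSemisimpleModule.exists_linearEquiv_fin_dfinsupp E (E ⧸ Module.jacobson E E)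
  refine ⟨k, S, fun T _ _ _ => ?_⟩
  have := IsSimpleModule.nontrivial E T
  obtain ⟨x, hx⟩ := exists_ne (0 : T)
  let f : E →ₗ[E] T := LinearMap.toSpanSingleton E T x
  have hf : Function.Surjective f := IsSimpleModule.toSpanSingleton_surjective E hx
  have hker : Module.jacobson E E ≤ LinearMap.ker f :=
    sInf_le (LinearMap.isCoatom_ker_of_surjective hf)
  let g := (Module.jacobson E E).liftQ f hker ∘ₗ e.symm.toLinearMap
  have hg : g ≠ 0 := fun h => hx <| by
    have := LinearMap.congr_fun h (e (Submodule.Quotient.mk 1))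
    have h1 : f 1 = 0 := by
      rw [← Submodule.liftQ_apply (Module.jacobson E E) f (h := hker)]
      simpa [g, -Submodule.liftQ_apply] using this
    simpa [f] using h1
  obtain ⟨i, hi⟩ : ∃ i, g ∘ₗ DFinsupp.lsingle i ≠ 0 := by
    by_contra! h
    exact hg (DFinsupp.lhom_ext' h)
  have := hS i
  exact ⟨i, ⟨(LinearEquiv.ofBijective _ (LinearMap.bijective_of_ne_zero hi)).symm⟩⟩

lemma IsSemisimpleModule.exists_linearEquiv_pi_pow {E : Type*} [Ring E] {k : ℕ}
    {S : Fin k → Type*} [∀ i, AddCommGroup (S i)] [∀ i, Module E (S i)]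
    {Q : Type v} [AddCommGroup Q] [Module E Q] [Module.Finite E Q] [IsSemisimpleModule E Q]
    (hS : ∀ (T : Type v) [AddCommGroup T] [Module E T] [IsSimpleModule E T],
      ∃ i, Nonempty (T ≃ₗ[E] S i)) :
    ∃ t : Fin k → ℕ, Nonempty (Q ≃ₗ[E] ∀ i, Fin (t i) → S i) := by
  obtain ⟨n, T, e, hT⟩ := IsSemisimpleModule.exists_linearEquiv_fin_dfinsupp E Q
  choose σ f using fun j => hS (T j)
  obtain ⟨t, ⟨e'⟩⟩ := _root_.exists_linearEquiv_pi_pow (E := E) S σ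
  exact ⟨t, ⟨e ≪≫ₗ DFinsupp.linearEquivFunOnFintype ≪≫ₗ
    LinearEquiv.piCongrRight (fun j => (f j).some) ≪≫ₗ e'⟩⟩

lemma exists_surjective_pi_pow {E : Type*} [Semiring E] {k : ℕ} (S : Fin k → Type*)
    [∀ i, AddCommMonoid (S i)] [∀ i, Module E (S i)] {t t' : Fin k → ℕ} (h : t ≤ t') :
    ∃ f : (∀ i, Fin (t' i) → S i) →ₗ[E] ∀ i, Fin (t i) → S i, Function.Surjective f := by
  let f (i : Fin k) : (Fin (t' i) → S i) →ₗ[E] Fin (t i) → S i :=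
    LinearMap.funLeft E (S i) (Fin.castLE (h i))
  exact ⟨LinearMap.piMap f, Function.Surjective.piMap fun i =>
    LinearMap.funLeft_surjective_of_injective E _ _ (Fin.castLE_injective (h i))⟩

/-- `N` is a direct summand of a finite direct sum of copies of `X`: the identity of `N` is a
finite sum of endomorphisms factoring through `X`. -/
def IsSummandOfPow (R : Type u) [CommRing R] (X : Type v) [AddCommGroup X] [Module R X]
    (N : Type w) [AddCommGroup N] [Module R N] : Prop :=
  ∃ (ι : Type) (_ : Fintype ι) (a : ι → N →ₗ[R] X) (b : ι → X →ₗ[R] N),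
    ∑ j, b j ∘ₗ a j = LinearMap.id

/-- `N` is isomorphic to a direct summand of `N'`. -/
def IsRetract (R : Type u) [CommRing R] (N : Type v) [AddCommGroup N] [Module R N]
    (N' : Type w) [AddCommGroup N'] [Module R N'] : Prop :=
  ∃ (f : N →ₗ[R] N') (g : N' →ₗ[R] N), g ∘ₗ f = LinearMap.id

section Retract

variable {R : Type u} [CommRing R] {X N N' N'' : Type v} [AddCommGroup X] [Module R X]
  [AddCommGroup N] [Module R N] [AddCommGroup N'] [Module R N'] [AddCommGroup N''] [Module R N'']

lemma IsRetract.refl (N : Type v) [AddCommGroup N] [Module R N] : IsRetract R N N :=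
  ⟨LinearMap.id, LinearMap.id, rfl⟩

lemma IsRetract.trans (h : IsRetract R N N') (h' : IsRetract R N' N'') : IsRetract R N N'' := by
  obtain ⟨f, g, h⟩ := h
  obtain ⟨f', g', h'⟩ := h'
  refine ⟨f' ∘ₗ f, g ∘ₗ g', LinearMap.ext fun x => ?_⟩
  have h1 := LinearMap.congr_fun h' (f x)
  have h2 := LinearMap.congr_fun h x
  simp only [LinearMap.comp_apply, LinearMap.id_apply] at h1 h2 ⊢
  rw [h1, h2]

lemma LinearEquiv.isRetract (e : N ≃ₗ[R] N') : IsRetract R N N' :=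
  ⟨e, e.symm, by ext; simp⟩

/-- A direct summand has a complement. -/
lemma IsRetract.exists_linearEquiv_prod (h : IsRetract R N N') :
    ∃ K : Submodule R N', IsRetract R K N' ∧ Nonempty (N' ≃ₗ[R] N × K) := by
  obtain ⟨f, g, h⟩ := h
  have hgf (x : N) : g (f x) = x := LinearMap.congr_fun h x
  let π : N' →ₗ[R] LinearMap.ker g :=
    (LinearMap.id - f ∘ₗ g).codRestrict _ fun x => by simp [hgf]
  refine ⟨LinearMap.ker g, ⟨Submodule.subtype _, π, ?_⟩, ⟨LinearEquiv.ofLinearMap (g.prod π)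
    (f.coprod (Submodule.subtype _)) ?_ ?_⟩⟩
  · ext x
    simp [π]
  · ext x <;> simp [π, hgf]
  · ext x
    simp [π]

lemma IsSummandOfPow.of_isRetract (hN' : IsSummandOfPow R X N') (h : IsRetract R N N') :
    IsSummandOfPow R X N := by
  obtain ⟨ι, _, a, b, hab⟩ := hN'
  obtain ⟨f, g, h⟩ := h
  refine ⟨ι, inferInstance, fun j => a j ∘ₗ f, fun j => g ∘ₗ b j, LinearMap.ext fun x => ?_⟩
  have h1 := LinearMap.congr_fun hab (f x)
  have h2 := LinearMap.congr_fun h x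
  simp only [LinearMap.sum_apply, LinearMap.comp_apply, LinearMap.id_apply] at h1 h2 ⊢
  rw [← map_sum, h1, h2]

lemma IsSummandOfPow.finite [Module.Finite R X] (h : IsSummandOfPow R X N) :
    Module.Finite R N := by
  obtain ⟨ι, _, a, b, hab⟩ := h
  refine .of_surjective (∑ j, b j ∘ₗ LinearMap.proj j : (ι → X) →ₗ[R] N) fun x =>
    ⟨fun j => a j x, ?_⟩
  simpa using LinearMap.congr_fun hab x

lemma IsSummandOfPow.projective (h : IsSummandOfPow R X N) :
    Module.Projective (Module.End R X) (N →ₗ[R] X) := by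
  obtain ⟨ι, _, a, b, hab⟩ := h
  let i : (N →ₗ[R] X) →ₗ[Module.End R X] ι → Module.End R X :=
    { toFun h j := h ∘ₗ b j, map_add' _ _ := rfl, map_smul' _ _ := rfl }
  refine .of_split i (Fintype.linearCombination (Module.End R X) a) (LinearMap.ext fun h => ?_)
  ext x
  have := congrArg h (LinearMap.congr_fun hab x)
  simpa [i, Fintype.linearCombination_apply] using this

/-- The contravariant functor `Hom(-, X)` is full on direct summands of powers of `X`. -/
lemma IsSummandOfPow.exists_comp_eq (hN' : IsSummandOfPow R X N')
    (φ : (N' →ₗ[R] X) →ₗ[Module.End R X] N →ₗ[R] X) :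
    ∃ f : N →ₗ[R] N', ∀ h : N' →ₗ[R] X, φ h = h ∘ₗ f := by
  obtain ⟨ι, _, a, b, hab⟩ := hN'
  refine ⟨∑ j, b j ∘ₗ φ (a j), fun h => ?_⟩
  have key : h = ∑ j, (h ∘ₗ b j : Module.End R X) • a j := by
    ext x
    simpa using congrArg h (LinearMap.congr_fun hab x).symm
  conv_lhs => rw [key, map_sum]
  ext x
  simp

/-- The contravariant functor `Hom(-, X)` is faithful on direct summands of powers of `X`. -/
lemma IsSummandOfPow.ext (hN : IsSummandOfPow R X N) {f g : N →ₗ[R] N}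
    (hfg : ∀ h : N →ₗ[R] X, h ∘ₗ f = h ∘ₗ g) : f = g := by
  obtain ⟨ι, _, a, b, hab⟩ := hN
  have key (f : N →ₗ[R] N) : f = ∑ j, b j ∘ₗ (a j ∘ₗ f) := by
    ext x
    simpa using (LinearMap.congr_fun hab (f x)).symm
  rw [key f, key g]
  simp_rw [hfg]

lemma IsSummandOfPow.isRetract_of_surjective (hN : IsSummandOfPow R X N)
    (hN' : IsSummandOfPow R X N') (φ : (N' →ₗ[R] X) →ₗ[Module.End R X] N →ₗ[R] X)
    (hφ : Function.Surjective φ) : IsRetract R N N' := by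
  have := hN.projective
  obtain ⟨ψ, hψ⟩ := Module.projective_lifting_property φ LinearMap.id hφ
  obtain ⟨f, hf⟩ := hN'.exists_comp_eq φ
  obtain ⟨g, hg⟩ := hN.exists_comp_eq ψ
  refine ⟨f, g, hN.ext fun h => ?_⟩
  rw [← LinearMap.comp_assoc, ← hg, ← hf]
  exact LinearMap.congr_fun hψ h

/-- The top of `Hom(N, X)` as a module over `End X`. -/
abbrev HomTop (R : Type u) [CommRing R] (X N : Type v) [AddCommGroup X] [Module R X]
    [AddCommGroup N] [Module R N] : Type v :=
  (N →ₗ[R] X) ⧸ Module.jacobson (Module.End R X) (N →ₗ[R] X)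

lemma IsSummandOfPow.isRetract_of_surjective_homTop
    [Module.Finite (Module.End R X) (N →ₗ[R] X)]
    (hN : IsSummandOfPow R X N) (hN' : IsSummandOfPow R X N')
    (φ : HomTop R X N' →ₗ[Module.End R X] HomTop R X N) (hφ : Function.Surjective φ) :
    IsRetract R N N' := by
  have := hN'.projective
  obtain ⟨ψ, hψ⟩ := Module.projective_lifting_property (Submodule.mkQ _)
    (φ ∘ₗ Submodule.mkQ _) (Submodule.mkQ_surjective (Module.jacobson (Module.End R X) (N →ₗ[R] X)))
  refine hN.isRetract_of_surjective hN' ψ (LinearMap.range_eq_top.1 ?_)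
  refine Module.eq_top_of_sup_jacobson (eq_top_iff.2 fun x _ => ?_)
  obtain ⟨y', hy'⟩ := hφ (Submodule.Quotient.mk x)
  obtain ⟨y, rfl⟩ := Submodule.mkQ_surjective _ y'
  have hy : Submodule.Quotient.mk (ψ y) = Submodule.Quotient.mk x :=
    (LinearMap.congr_fun hψ y).trans hy'
  rw [Submodule.Quotient.eq] at hy
  rw [← sub_sub_cancel (ψ y) x]
  exact Submodule.sub_mem _ (Submodule.mem_sup_left ⟨y, rfl⟩) (Submodule.mem_sup_right hy)

/-- Direct summands of finite powers of `X`, ordered by being direct summands of each other, are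
controlled by vectors of natural numbers. -/
lemma exists_isRetract_of_le [IsNoetherianRing R] [IsLocalRing R] (X : Type u) [AddCommGroup X]
    [Module R X] [Module.Finite R X] :
    ∃ (k : ℕ) (v : ModuleCat.{u} R → Fin k → ℕ), ∀ N N' : ModuleCat.{u} R,
      IsSummandOfPow R X N → IsSummandOfPow R X N' → v N ≤ v N' → IsRetract R N N' := by
  obtain ⟨k, S, hS⟩ := exists_finite_simple_modules.{u, u}
    (isSemisimpleModule_quotient_jacobson R (Module.End R X) (Module.End R X))
  have hfin (N : ModuleCat.{u} R) (hN : IsSummandOfPow R X N) :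
      Module.Finite (Module.End R X) (N →ₗ[R] X) :=
    have := hN.finite
    .of_restrictScalars_finite R _ _
  have hv (N : ModuleCat.{u} R) : ∃ t : Fin k → ℕ, IsSummandOfPow R X N →
      Nonempty (HomTop R X N ≃ₗ[Module.End R X] ∀ i, Fin (t i) → S i) := by
    by_cases hN : IsSummandOfPow R X N
    · have := hN.finite
      have := hfin N hN
      have := isSemisimpleModule_quotient_jacobson R (Module.End R X) (N →ₗ[R] X)
      obtain ⟨t, ht⟩ := IsSemisimpleModule.exists_linearEquiv_pi_pow hS (Q := HomTop R X N)
      exact ⟨t, fun _ => ht⟩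
    · exact ⟨0, fun h => absurd h hN⟩
  choose v hv using hv
  refine ⟨k, v, fun N N' hN hN' hle => ?_⟩
  obtain ⟨e⟩ := hv N hN
  obtain ⟨e'⟩ := hv N' hN'
  obtain ⟨f, hf⟩ := exists_surjective_pi_pow (E := Module.End R X) (fun i => S i) hle
  have := hfin N hN
  exact hN.isRetract_of_surjective_homTop hN' (e.symm.toLinearMap ∘ₗ f ∘ₗ e'.toLinearMap)
    (e.symm.surjective.comp (hf.comp e'.surjective))

end Retract

section Decomposition

variable {R : Type u} [CommRing R]

/-- In a class `D` of modules closed under direct summands, all direct summands of finite powers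
of a single module, finitely many nonzero members suffice to split off a direct summand from every
nonzero member. -/
lemma exists_finite_basis_isRetract [IsNoetherianRing R] [IsLocalRing R] (X : Type u)
    [AddCommGroup X] [Module R X] [Module.Finite R X] (D : ModuleCat.{u} R → Prop)
    (hD : ∀ N, D N → IsSummandOfPow R X N) :
    ∃ (s : ℕ) (B : Fin s → ModuleCat.{u} R), (∀ i, D (B i) ∧ Nontrivial (B i)) ∧
      ∀ N, D N → Nontrivial N → ∃ i, IsRetract R (B i) N := by
  obtain ⟨k, v, hv⟩ := exists_isRetract_of_le (R := R) X
  let A : Set (Fin k → ℕ) := {a | ∃ N, D N ∧ Nontrivial N ∧ v N = a}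
  have hA : {a | Minimal (· ∈ A) a}.Finite :=
    WellQuasiOrderedLE.finite_of_isAntichain (setOfPred_minimal_antichain _)
  obtain ⟨s, a, ha⟩ := hA.fin_param
  have hmem (i : Fin s) : a i ∈ A := (ha.2.le (Set.mem_range_self i)).1
  choose B hB hB' hvB using hmem
  refine ⟨s, B, fun i => ⟨hB i, hB' i⟩, fun N hN hN' => ?_⟩
  obtain ⟨b, hb, hbmin⟩ := (Set.isPWO_of_wellQuasiOrderedLE A).exists_le_minimal ⟨N, hN, hN', rfl⟩
  obtain ⟨i, rfl⟩ : b ∈ Set.range a := ha.2.ge hbmin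
  exact ⟨i, hv _ _ (hD _ (hB i)) (hD _ hN) (hvB i ▸ hb)⟩

open IsLocalRing TensorProduct in
lemma finrank_residueField_tensorProduct_lt [IsLocalRing R] {N P K : Type u} [AddCommGroup N]
    [Module R N] [AddCommGroup P] [Module R P] [AddCommGroup K] [Module R K] [Module.Finite R N]
    [Module.Finite R K] [Nontrivial N] (e : P ≃ₗ[R] N × K) :
    Module.finrank (ResidueField R) (ResidueField R ⊗[R] K) <
      Module.finrank (ResidueField R) (ResidueField R ⊗[R] P) := by
  have hfree (V : Type u) [AddCommGroup V] [Module (ResidueField R) V] :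
      Module.Free (ResidueField R) V := .of_divisionRing _ _
  have := hfree (ResidueField R ⊗[R] N)
  have := hfree (ResidueField R ⊗[R] K)
  have : Nontrivial (ResidueField R ⊗[R] N) := by
    rw [← not_subsingleton_iff_nontrivial, subsingleton_tensorProduct]
    exact not_subsingleton _
  have hpos : 0 < Module.finrank (ResidueField R) (ResidueField R ⊗[R] N) :=
    Module.finrank_pos_iff_of_free _ _ |>.2 ‹_›
  rw [(e.baseChange R (ResidueField R) _ _ ≪≫ₗ
    TensorProduct.prodRight R (ResidueField R) (ResidueField R) N K).finrank_eq,
    Module.finrank_prod]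
  omega

open IsLocalRing TensorProduct in
/-- If every nonzero module in a class closed under direct summands has a direct summand among the
nonzero modules `B i`, then every module in the class is a finite direct sum of copies of the
`B i`. -/
lemma exists_linearEquiv_pi_of_isRetract [IsLocalRing R] {D : ModuleCat.{u} R → Prop}
    (hfin : ∀ N, D N → Module.Finite R N)
    (hD : ∀ N N' : ModuleCat.{u} R, D N' → IsRetract R N N' → D N)
    {s : ℕ} {B : Fin s → ModuleCat.{u} R} (hB : ∀ i, D (B i) ∧ Nontrivial (B i))
    (h : ∀ N, D N → Nontrivial N → ∃ i, IsRetract R (B i) N) (N : ModuleCat.{u} R) (hN : D N) :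
    ∃ (n : ℕ) (σ : Fin n → Fin s), Nonempty (N ≃ₗ[R] ∀ j, B (σ j)) := by
  induction hd : Module.finrank (ResidueField R) (ResidueField R ⊗[R] N) using
    Nat.strong_induction_on generalizing N with
  | _ d ih =>
  rcases subsingleton_or_nontrivial N with hs | hs
  · exact ⟨0, Fin.elim0, ⟨0⟩⟩
  obtain ⟨i, hi⟩ := h N hN hs
  obtain ⟨K, hK, ⟨e⟩⟩ := hi.exists_linearEquiv_prod
  have hDK : D (ModuleCat.of R K) := hD _ _ hN hK
  have := hfin _ hDK
  have := hfin _ (hB i).1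
  have := (hB i).2
  have hlt : Module.finrank (ResidueField R) (ResidueField R ⊗[R] K) < d :=
    hd ▸ finrank_residueField_tensorProduct_lt e
  obtain ⟨n, σ, ⟨e'⟩⟩ := ih _ hlt (ModuleCat.of R K) hDK rfl
  exact ⟨n + 1, Fin.cons i σ, ⟨e ≪≫ₗ (LinearEquiv.refl R _).prodCongr e' ≪≫ₗ
    Fin.consLinearEquiv R fun j => B (Fin.cons (α := fun _ => Fin s) i σ j)⟩⟩

end Decomposition

section Frobenius

variable {R : Type u} [CommRing R] {p : ℕ} [Fact p.Prime] [CharP R p]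

lemma frobIso_iff {e : ℕ} {M : Type v} [AddCommMonoid M] [Module R M]
    {N : Type w} [AddCommMonoid N] [Module R N] :
    FrobIso R (p ^ e) M N ↔ Nonempty (FStar R p e M ≃ₗ[R] N) :=
  ⟨fun ⟨g, hg⟩ => ⟨{ (show FStar R p e M ≃+ N from g) with map_smul' := hg }⟩,
    fun ⟨g⟩ => ⟨g.toAddEquiv, g.map_smul⟩⟩

variable {M N : Type u} [AddCommGroup M] [Module R M] [AddCommGroup N] [Module R N]

/-- Frobenius pushforward is functorial, hence preserves direct summands. -/
lemma IsRetract.fStar (d : ℕ) (h : IsRetract R N M) :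
    IsRetract R (FStar R p d N) (FStar R p d M) := by
  obtain ⟨f, g, h⟩ := h
  exact ⟨{ toFun := f, map_add' := f.map_add, map_smul' := fun r x => f.map_smul (r ^ p ^ d) x },
    { toFun := g, map_add' := g.map_add, map_smul' := fun r x => g.map_smul (r ^ p ^ d) x },
    LinearMap.ext fun x => LinearMap.congr_fun h x⟩

variable (R p M) in
/-- Iterating Frobenius pushforwards. -/
def FStar.compEquiv (d e : ℕ) : FStar R p d (FStar R p e M) ≃ₗ[R] FStar R p (d + e) M :=
  { AddEquiv.refl M with
    map_smul' := fun r x => by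
      change ((r ^ p ^ d) ^ p ^ e • (show M from x) : M) = (r ^ p ^ (d + e) • (show M from x) : M)
      rw [← pow_mul, ← pow_add] }

end Frobenius

lemma isSummandOfPow_pi_pow {R : Type u} [CommRing R] {s : ℕ} (M : Fin s → ModuleCat.{u} R)
    (t : Fin s → ℕ) : IsSummandOfPow R (∀ i, M i) (∀ i, Fin (t i) → M i) := by
  refine ⟨Σ i, Fin (t i), inferInstance,
    fun x => LinearMap.single R _ x.1 ∘ₗ LinearMap.proj x.2 ∘ₗ LinearMap.proj x.1,
    fun x => LinearMap.single R _ x.1 ∘ₗ LinearMap.single R _ x.2 ∘ₗ LinearMap.proj x.1, ?_⟩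
  refine LinearMap.ext fun y => ?_
  have hsum (i : Fin s) : ∑ j, LinearMap.single R (fun _ : Fin (t i) => M i) j (y i j) = y i :=
    Finset.univ_sum_single (y i)
  simp only [LinearMap.sum_apply, LinearMap.comp_apply, LinearMap.proj_apply, LinearMap.id_apply,
    Fintype.sum_sigma, LinearMap.single_apply R (fun i => M i), Pi.single_eq_same]
  refine (Finset.sum_congr rfl fun i _ => ?_).trans (Finset.univ_sum_single y)
  exact (map_sum (LinearMap.single R (fun i => Fin (t i) → M i) i) _ _).symm.trans
    (congrArg _ (hsum i))

theorem statement6 (p : ℕ) [Fact p.Prime] (R : Type u) [CommRing R] [IsNoetherianRing R]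
    [IsLocalRing R] [CharP R p]
    (M : Type u) [AddCommGroup M] [Module R M] [Module.Finite R M]
    (hM : HasFFRTModule p R M) :
    -- there is an FFRT system `{N 0, …, N (s-1)}` by which `M` has FFRT
    ∃ (s : ℕ) (N : Fin s → ModuleCat.{u} R),
      (∀ i, Module.Finite R (N i)) ∧
      -- (i) every `F_*ᵉ M` is a finite direct sum of copies of the `N i`
      (∀ e : ℕ, 1 ≤ e → ∃ t : Fin s → ℕ,
        FrobIso R (p ^ e) M (⨁ i, Fin (t i) → ↥(N i))) ∧
      -- (ii) every `F_*¹ (N j)` is a finite direct sum of copies of the `N i`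
      (∀ j, ∃ t : Fin s → ℕ,
        FrobIso R (p ^ 1) ↥(N j) (⨁ i, Fin (t i) → ↥(N i))) := by
  obtain ⟨r, L, hL, hFL⟩ := hM
  let D : ModuleCat.{u} R → Prop := fun N => ∃ e, 1 ≤ e ∧ IsRetract R N (FStar R p e M)
  have hDX (N) (hN : D N) : IsSummandOfPow R (∀ i, L i) N := by
    obtain ⟨e, he, hN⟩ := hN
    obtain ⟨t, ht⟩ := hFL e he
    obtain ⟨g⟩ := frobIso_iff.1 ht
    exact (isSummandOfPow_pi_pow L t).of_isRetract
      (hN.trans (g ≪≫ₗ DirectSum.linearEquivFunOnFintype R _ _).isRetract)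
  have hDfin (N) (hN : D N) : Module.Finite R N := (hDX N hN).finite
  obtain ⟨s, B, hB, hBD⟩ := exists_finite_basis_isRetract (∀ i, L i) D hDX
  have hdecomp (N : ModuleCat.{u} R) (hN : D N) :
      ∃ t : Fin s → ℕ, Nonempty (N ≃ₗ[R] ⨁ i, Fin (t i) → B i) := by
    obtain ⟨n, σ, ⟨e⟩⟩ := exists_linearEquiv_pi_of_isRetract hDfin
      (fun N N' ⟨d, hd, hN'⟩ h => ⟨d, hd, h.trans hN'⟩) hB hBD N hN
    obtain ⟨t, ⟨e'⟩⟩ := exists_linearEquiv_pi_pow (E := R) (fun i => B i) σ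
    exact ⟨t, ⟨e ≪≫ₗ e' ≪≫ₗ (DirectSum.linearEquivFunOnFintype R _ _).symm⟩⟩
  refine ⟨s, B, fun i => hDfin _ (hB i).1, fun e he => ?_, fun j => ?_⟩
  · obtain ⟨t, ht⟩ := hdecomp (ModuleCat.of R (FStar R p e M)) ⟨e, he, .refl _⟩
    exact ⟨t, frobIso_iff.2 ht⟩
  · obtain ⟨e, he, hj⟩ := (hB j).1
    obtain ⟨t, ht⟩ := hdecomp (ModuleCat.of R (FStar R p 1 (B j)))
      ⟨1 + e, by omega, (hj.fStar 1).trans (FStar.compEquiv R p M 1 e).isRetract⟩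
    exact ⟨t, frobIso_iff.2 ht⟩
end

section
/- Let K be a field of prime characteristic p with b = [K:K^p] < ∞, let S be either K[x_1,…,x_n] or K[[x_1,…,x_n]], and let f = x_1^{d_1} ⋯ x_n^{d_n} where each d_j is a nonnegative integer. Let e ≥ 1 with q = p^e > max{d_1,…,d_n} + 1, and let 1 ≤ k ≤ q−1. Set Γ = {c = (c_1,…,c_n) ∈ ℤ^n : 0 ≤ c_j ≤ d_j for all j}, and for c ∈ Γ define η_k(c) = b^e · ∏_{j=1}^n η_k(c_j), where η_k(c_j) = q − |c_j q − k d_j| if |c_j q − k d_j| < q and η_k(c_j) = 0 otherwise. Then F_*^e(S/f^kS) ≅ ⨁_{c ∈ Γ} (S/(x_1^{c_1} ⋯ x_n^{c_n})S)^{⊕ η_k(c)} as S-modules, with the convention that M^{⊕0} = 0. -/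
open scoped DirectSum

universe u v w

/-- The decomposition of `F_*ᵉ (S / fᵏ S)` for the monomial `f = x₁^{d₁} ⋯ xₙ^{dₙ}`:
`F_*ᵉ (S/fᵏS) ≅ ⨁_{c ∈ Γ} (S/(x₁^{c₁} ⋯ xₙ^{cₙ}))^{η_k(c)}` as `S`-modules, where
`Γ = {c : 0 ≤ cⱼ ≤ dⱼ}` and `η_k(c) = bᵉ ∏ⱼ (q - |cⱼ q - k dⱼ|)` (interpreted as `0`
whenever `|cⱼ q - k dⱼ| ≥ q`, via truncated subtraction). -/
def MonomialFrobDecomp (p b e k n : ℕ) (S : Type u) [CommRing S] (x : Fin n → S)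
    (dd : Fin n → ℕ) : Prop :=
  FrobIso S (p ^ e) (S ⧸ Ideal.span {(∏ j, x j ^ dd j) ^ k})
    (⨁ c : {c : Fin n → ℕ // ∀ j, c j ≤ dd j},
      Fin (b ^ e * ∏ j, (p ^ e - ((c.1 j : ℤ) * (p ^ e : ℤ) - (k : ℤ) * (dd j : ℤ)).natAbs)) →
        S ⧸ Ideal.span {∏ j, x j ^ c.1 j})

section FrobeniusDecomposition

open Function

theorem natCeil_div_le_iff {q : ℕ} (hq : 0 < q) (N i m : ℕ) :
    (N - i + (q - 1)) / q ≤ m ↔ N ≤ i + q * m := by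
  rw [← Nat.lt_succ_iff, Nat.div_lt_iff_lt_mul hq, Nat.succ_mul, mul_comm m q]
  omega

/-- The number of residues `i < q` for which `⌈(N - i) / q⌉ = c`. -/
theorem card_natCeil_div_eq {q : ℕ} (hq : 0 < q) (N c : ℕ) :
    Fintype.card {i : Fin q // (N - i + (q - 1)) / q = c} =
      q - ((c : ℤ) * (q : ℤ) - (N : ℤ)).natAbs := by
  have key : ∀ i : ℕ, (N - i + (q - 1)) / q = c ↔
      N ≤ i + q * c ∧ (c = 0 ∨ i + q * c < N + q) := by
    intro i
    rw [← natCeil_div_le_iff hq]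
    rcases c with _ | c
    · simp
    · have h := natCeil_div_le_iff hq N i c
      rw [mul_add, mul_one]
      omega
  rw [Fintype.card_subtype]
  have hcard : (Finset.univ.filter fun i : Fin q => (N - i + (q - 1)) / q = c).card =
      ((Finset.range q).filter fun i => (N - i + (q - 1)) / q = c).card := by
    rw [← Finset.card_map Fin.valEmbedding]
    congr 1
    ext i
    simp only [Finset.mem_map, Finset.mem_filter, Finset.mem_univ, true_and, Finset.mem_range,
      Fin.valEmbedding_apply]
    exact ⟨fun ⟨j, hj, hji⟩ => hji ▸ ⟨j.2, hj⟩, fun ⟨hi, h⟩ => ⟨⟨i, hi⟩, h, rfl⟩⟩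
  have hcq : (c : ℤ) * (q : ℤ) = ((q * c : ℕ) : ℤ) := by push_cast; ring
  rw [hcard, hcq]
  rcases Nat.eq_zero_or_pos c with rfl | hc
  · have : ((Finset.range q).filter fun i => (N - i + (q - 1)) / q = 0) = Finset.Ico N q := by
      ext i
      simp only [Finset.mem_filter, Finset.mem_range, key, Finset.mem_Ico]
      omega
    rw [this, Nat.card_Ico]
    omega
  · have : ((Finset.range q).filter fun i => (N - i + (q - 1)) / q = c) =
        Finset.Ico (N - q * c) (min q (N + q - q * c)) := by
      ext i
      simp only [Finset.mem_filter, Finset.mem_range, key, Finset.mem_Ico]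
      omega
    rw [this, Nat.card_Ico]
    omega

/-- The family `ω` is a basis of `K` over its subfield of `q`-th powers. -/
def IsPowBasis {K : Type*} [Semiring K] (q : ℕ) {ι : Type*} [Fintype ι] (ω : ι → K) : Prop :=
  Bijective fun a : ι → K => ∑ β, ω β * a β ^ q

theorem IsPowBasis.mul {K : Type*} [Field K] {p : ℕ} [Fact p.Prime] [CharP K p] {s t : ℕ}
    {ι κ : Type*} [Fintype ι] [Fintype κ] {ω : ι → K} {υ : κ → K}
    (hω : IsPowBasis (p ^ s) ω) (hυ : IsPowBasis (p ^ t) υ) :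
    IsPowBasis (p ^ (s + t)) fun β : ι × κ => ω β.1 * υ β.2 ^ p ^ s := by
  have hcomp : (fun a : ι × κ → K => ∑ β, ω β.1 * υ β.2 ^ p ^ s * a β ^ p ^ (s + t)) =
      (fun a : ι → K => ∑ β, ω β * a β ^ p ^ s) ∘
        (Pi.map fun _ => fun a : κ → K => ∑ γ, υ γ * a γ ^ p ^ t) ∘ Function.curry := by
    funext a
    simp only [Function.comp_apply, Pi.map_apply, Function.curry, Fintype.sum_prod_type,
      sum_pow_char_pow, mul_pow, Finset.mul_sum]
    refine Finset.sum_congr rfl fun β _ => Finset.sum_congr rfl fun γ _ => ?_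
    rw [← pow_mul, pow_add, mul_comm (p ^ t), mul_assoc]
  unfold IsPowBasis
  rw [hcomp]
  exact hω.comp ((Function.Bijective.piMap fun _ => hυ).comp (Equiv.curry _ _ _).bijective)

theorem IsPowBasis.reindex {K : Type*} [Semiring K] {q : ℕ} {ι κ : Type*} [Fintype ι] [Fintype κ]
    {ω : ι → K} (hω : IsPowBasis q ω) (f : κ ≃ ι) : IsPowBasis q (ω ∘ f) := by
  have hcomp : (fun a : κ → K => ∑ β, (ω ∘ f) β * a β ^ q) =
      (fun a : ι → K => ∑ β, ω β * a β ^ q) ∘ (Equiv.arrowCongr f (Equiv.refl K)) := by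
    funext a
    exact Fintype.sum_equiv f _ _ (by simp)
  unfold IsPowBasis
  rw [hcomp]
  exact hω.comp (Equiv.bijective _)

theorem exists_isPowBasis {K : Type*} [Field K] {p : ℕ} [Fact p.Prime] [CharP K p]
    (hKfin : Module.Finite K (FStar K p 1 K)) (e : ℕ) :
    ∃ ω : Fin (Module.finrank K (FStar K p 1 K) ^ e) → K, IsPowBasis (p ^ e) ω := by
  induction e with
  | zero =>
    refine ⟨fun _ => 1, ?_⟩
    unfold IsPowBasis
    simp only [pow_zero, pow_one, one_mul]
    have : Unique (Fin (Module.finrank K (FStar K p 1 K) ^ 0)) := by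
      rw [pow_zero]; infer_instance
    simp only [Fintype.sum_unique]
    exact (Equiv.funUnique _ K).bijective
  | succ e ih =>
    obtain ⟨ω, hω⟩ := ih
    let B := Module.finBasis K (FStar K p 1 K)
    let υ : Fin (Module.finrank K (FStar K p 1 K)) → K := B
    have hυ : IsPowBasis (p ^ 1) υ := by
      have h : (fun a : Fin (Module.finrank K (FStar K p 1 K)) → K =>
          ∑ β, υ β * a β ^ p ^ 1) = B.equivFun.symm := by
        funext a
        rw [B.equivFun_symm_apply]
        refine Finset.sum_congr rfl fun β _ => ?_
        exact mul_comm _ _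
      unfold IsPowBasis
      rw [h]
      exact B.equivFun.symm.bijective
    exact ⟨_, (hω.mul hυ).reindex (finProdFinEquiv.trans (finCongr (pow_succ _ _).symm)).symm⟩

theorem frobIso_quotient_of_surjective {R : Type*} [CommRing R] {q : ℕ} {I : Ideal R}
    {N : Type*} [AddCommGroup N] [Module R N] (θ : R →+ N) (hθ : Surjective θ)
    (hker : ∀ h, θ h = 0 ↔ h ∈ I) (hsmul : ∀ r h, θ (r ^ q * h) = r • θ h) :
    FrobIso R q (R ⧸ I) N := by
  have hout : ∀ h : R, θ (Quotient.out (Ideal.Quotient.mk I h)) = θ h := by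
    intro h
    rw [← sub_eq_zero, ← map_sub, hker, ← Ideal.Quotient.eq]
    exact Quotient.out_eq _
  have hsurj := Ideal.Quotient.mk_surjective (I := I)
  let g : R ⧸ I →+ N := AddMonoidHom.mk' (fun x => θ (Quotient.out x)) <| by
    intro x y
    obtain ⟨a, rfl⟩ := hsurj x
    obtain ⟨b, rfl⟩ := hsurj y
    rw [← map_add, hout, hout, hout, map_add]
  have hg : ∀ h, g (Ideal.Quotient.mk I h) = θ h := hout
  have hbij : Bijective g := by
    refine ⟨(injective_iff_map_eq_zero g).2 fun x hx => ?_, fun y => ?_⟩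
    · obtain ⟨a, rfl⟩ := hsurj x
      rwa [Ideal.Quotient.eq_zero_iff_mem, ← hker, ← hg]
    · obtain ⟨a, rfl⟩ := hθ y
      exact ⟨_, hg a⟩
  refine ⟨AddEquiv.ofBijective g hbij, fun r m => ?_⟩
  obtain ⟨a, rfl⟩ := hsurj m
  change g (Ideal.Quotient.mk I (r ^ q * a)) = r • g (Ideal.Quotient.mk I a)
  rw [hg, hg, hsmul]

/-- A tuple of residues modulo `q`, as an exponent vector. -/
noncomputable def residueExponent {n q : ℕ} (i : Fin n → Fin q) : Fin n →₀ ℕ :=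
  Finsupp.equivFunOnFinite.symm fun t => i t

@[simp]
theorem residueExponent_apply {n q : ℕ} (i : Fin n → Fin q) (t : Fin n) :
    residueExponent i t = i t := rfl

theorem exists_residueExponent_add {n q : ℕ} (hq : 0 < q) (m : Fin n →₀ ℕ) :
    ∃ (i : Fin n → Fin q) (m' : Fin n →₀ ℕ), m = residueExponent i + q • m' := by
  refine ⟨fun t => ⟨m t % q, Nat.mod_lt _ hq⟩,
    Finsupp.equivFunOnFinite.symm fun t => m t / q, ?_⟩
  ext t
  simp [Nat.mod_add_div]

theorem MvPowerSeries.coeff_monomial_mul_pow_char_pow {K : Type*} [Field K] {p : ℕ}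
    [Fact p.Prime] [CharP K p] {n e : ℕ} (i j : Fin n → Fin (p ^ e)) (m : Fin n →₀ ℕ) (a : K)
    (g : MvPowerSeries (Fin n) K) :
    coeff (residueExponent i + p ^ e • m) (monomial (residueExponent j) a * g ^ p ^ e) =
      if i = j then a * coeff m g ^ p ^ e else 0 := by
  have hp : p ≠ 0 := (Fact.out : p.Prime).ne_zero
  have : ExpChar K p := .prime Fact.out
  rw [← map_iterateFrobenius_expand p hp]
  split_ifs with hij
  · rw [hij, coeff_add_monomial_mul, coeff_map, coeff_expand_smul, iterateFrobenius_def]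
  · rw [coeff_monomial_mul]
    split_ifs with hle
    · obtain ⟨t, ht⟩ := Function.ne_iff.1 hij
      rw [coeff_map, coeff_expand_of_not_dvd (i := t), map_zero, mul_zero]
      rintro ⟨s, hs⟩
      have hlt := hle t
      simp only [Finsupp.coe_tsub, Pi.sub_apply, Finsupp.coe_add, Pi.add_apply,
        residueExponent_apply, Finsupp.coe_smul, Pi.smul_apply, smul_eq_mul] at hs hlt
      have heq : (i t : ℕ) + p ^ e * m t = j t + p ^ e * s := by omega
      refine ht (Fin.ext ?_)
      have := congrArg (· % p ^ e) heq
      simpa [Nat.add_mul_mod_self_left, Nat.mod_eq_of_lt (i t).2, Nat.mod_eq_of_lt (j t).2]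
        using this
    · rfl

theorem MvPowerSeries.prod_X_pow {K : Type*} [CommRing K] {n : ℕ} (c : Fin n → ℕ) :
    ∏ j, (X j : MvPowerSeries (Fin n) K) ^ c j =
      monomial (Finsupp.equivFunOnFinite.symm c) 1 := by
  rw [monomial_eq', map_one, one_mul, Finsupp.prod_fintype _ _ (by simp)]
  rfl

/-- The image of `ι` in the power series ring is stable under reindexing the coefficients along an
injection and applying a map fixing `0` to them. -/
def CoeffReindexClosed {K S : Type*} [CommRing K] [CommRing S] {n : ℕ}
    (ι : S →+* MvPowerSeries (Fin n) K) : Prop :=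
  ∀ (h : S) (φ : K → K), φ 0 = 0 → ∀ τ : (Fin n →₀ ℕ) → (Fin n →₀ ℕ),
    Injective τ → ∃ h' : S, ∀ m, (ι h').coeff m = φ ((ι h).coeff (τ m))

section Embedding

variable {K : Type*} [Field K] {p : ℕ} {n : ℕ}
  {S : Type*} [CommRing S] {ι : S →+* MvPowerSeries (Fin n) K} {x : Fin n → S}

theorem mem_span_prod_pow_iff (hι : Injective ι) (hx : ∀ j, ι (x j) = MvPowerSeries.X j)
    (hrange : CoeffReindexClosed ι)
    (c : Fin n → ℕ) (h : S) :
    h ∈ Ideal.span {∏ j, x j ^ c j} ↔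
      ∀ m : Fin n →₀ ℕ, ¬ Finsupp.equivFunOnFinite.symm c ≤ m → (ι h).coeff m = 0 := by
  have hmon : ι (∏ j, x j ^ c j) =
      MvPowerSeries.monomial (Finsupp.equivFunOnFinite.symm c) 1 := by
    simp_rw [map_prod, map_pow, hx, MvPowerSeries.prod_X_pow]
  rw [Ideal.mem_span_singleton]
  constructor
  · rintro ⟨u, rfl⟩ m hm
    rw [map_mul, hmon, MvPowerSeries.coeff_monomial_mul, if_neg hm]
  · intro H
    obtain ⟨u, hu⟩ := hrange h id rfl (Finsupp.equivFunOnFinite.symm c + ·)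
      (add_right_injective _)
    refine ⟨u, hι ?_⟩
    ext m
    rw [map_mul, hmon, MvPowerSeries.coeff_monomial_mul]
    split_ifs with hm
    · rw [hu, one_mul, id, add_tsub_cancel_of_le hm]
    · exact H m hm

/-- `F_*ᵉ S` is free, with basis the products `ω β * x ^ i` for `i` a tuple of residues. -/
theorem exists_frobenius_coordinates [Fact p.Prime] [CharP K p] {e N : ℕ} (hι : Injective ι)
    (hx : ∀ j, ι (x j) = MvPowerSeries.X j)
    (hC : ∀ a, ∃ s : S, ι s = MvPowerSeries.C a)
    (hrange : CoeffReindexClosed ι)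
    {ω : Fin N → K} (hω : IsPowBasis (p ^ e) ω) :
    ∃ Φ : (Fin N × (Fin n → Fin (p ^ e)) → S) ≃+ S,
      (∀ r g, Φ (r • g) = r ^ p ^ e * Φ g) ∧
      ∀ g i m, (ι (Φ g)).coeff (residueExponent i + p ^ e • m) =
        ∑ β, ω β * ((ι (g (β, i))).coeff m) ^ p ^ e := by
  have hp : p ≠ 0 := (Fact.out : p.Prime).ne_zero
  have hq : 0 < p ^ e := pow_pos (Nat.pos_of_ne_zero hp) e
  have : CharP (MvPowerSeries (Fin n) K) p := charP_of_injective_ringHom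
    (f := MvPowerSeries.C) MvPowerSeries.C_injective p
  have : CharP S p := RingHom.charP ι hι p
  choose κ hκ using hC
  let Φ₀ : (Fin N × (Fin n → Fin (p ^ e)) → S) →+ S :=
    AddMonoidHom.mk' (fun g => ∑ b, κ (ω b.1) * (∏ j, x j ^ (b.2 j : ℕ)) * g b ^ p ^ e) <| by
      intro g g'
      simp only [Pi.add_apply, add_pow_char_pow, mul_add, Finset.sum_add_distrib]
  have hcoeff : ∀ g i m, (ι (Φ₀ g)).coeff (residueExponent i + p ^ e • m) =
      ∑ β, ω β * ((ι (g (β, i))).coeff m) ^ p ^ e := by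
    intro g i m
    have hterm : ∀ b : Fin N × (Fin n → Fin (p ^ e)),
        ι (κ (ω b.1) * (∏ j, x j ^ (b.2 j : ℕ)) * g b ^ p ^ e) =
          MvPowerSeries.monomial (residueExponent b.2) (ω b.1) * ι (g b) ^ p ^ e := by
      intro b
      simp_rw [map_mul, map_pow, map_prod, map_pow, hκ, hx, MvPowerSeries.prod_X_pow,
        ← MvPowerSeries.monomial_zero_eq_C_apply, MvPowerSeries.monomial_mul_monomial, zero_add,
        mul_one]
      rfl
    change (ι (∑ b, _)).coeff _ = _
    simp_rw [map_sum, hterm, MvPowerSeries.coeff_monomial_mul_pow_char_pow,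
      Fintype.sum_prod_type]
    simp
  have hbij : Bijective Φ₀ := by
    constructor
    · intro g g' hgg'
      funext ⟨β, i⟩
      apply hι
      ext m
      have h := (hcoeff g i m).symm.trans (hgg' ▸ hcoeff g' i m)
      exact congrFun (hω.1 h) β
    · intro h
      let L := Equiv.ofBijective _ hω
      have hL0 : L.symm 0 = 0 := by
        rw [Equiv.symm_apply_eq]
        change 0 = ∑ β, ω β * (0 : K) ^ p ^ e
        simp [zero_pow hq.ne']
      have hτ : ∀ i : Fin n → Fin (p ^ e),
          Injective fun m : Fin n →₀ ℕ => residueExponent i + p ^ e • m := fun i =>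
        (add_right_injective _).comp fun a b hab => by
          ext t
          have := DFunLike.congr_fun hab t
          simpa [hp] using this
      choose g hg using fun b : Fin N × (Fin n → Fin (p ^ e)) =>
        hrange h (fun a => L.symm a b.1) (by rw [hL0]; rfl) _ (hτ b.2)
      refine ⟨g, hι ?_⟩
      ext m
      obtain ⟨i, m', rfl⟩ := exists_residueExponent_add hq m
      rw [hcoeff]
      simp_rw [hg]
      exact L.apply_symm_apply _
  refine ⟨AddEquiv.ofBijective Φ₀ hbij, fun r g => ?_, hcoeff⟩
  change ∑ b, _ = _ * ∑ b, _
  rw [Finset.mul_sum]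
  refine Finset.sum_congr rfl fun b _ => ?_
  rw [Pi.smul_apply, smul_eq_mul, mul_pow]
  ring

theorem mem_span_prod_pow_iff_coordinates [Fact p.Prime] {e N : ℕ} (hι : Injective ι)
    (hx : ∀ j, ι (x j) = MvPowerSeries.X j)
    (hrange : CoeffReindexClosed ι)
    {ω : Fin N → K} (hω : IsPowBasis (p ^ e) ω)
    {g : Fin N × (Fin n → Fin (p ^ e)) → S} {h : S}
    (hcoeff : ∀ i m, (ι h).coeff (residueExponent i + p ^ e • m) =
        ∑ β, ω β * ((ι (g (β, i))).coeff m) ^ p ^ e) (c : Fin n → ℕ) :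
    h ∈ Ideal.span {∏ j, x j ^ c j} ↔
      ∀ b, g b ∈ Ideal.span {∏ j, x j ^ ((c j - b.2 j + (p ^ e - 1)) / p ^ e)} := by
  have hq : 0 < p ^ e := pow_pos (Fact.out : p.Prime).pos e
  simp_rw [mem_span_prod_pow_iff hι hx hrange]
  have hle : ∀ (i : Fin n → Fin (p ^ e)) (m : Fin n →₀ ℕ),
      Finsupp.equivFunOnFinite.symm (fun j => (c j - i j + (p ^ e - 1)) / p ^ e) ≤ m ↔
        Finsupp.equivFunOnFinite.symm c ≤ residueExponent i + p ^ e • m := by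
    intro i m
    simp [Finsupp.le_def, natCeil_div_le_iff hq]
  have hzero : ∀ i m, (ι h).coeff (residueExponent i + p ^ e • m) = 0 ↔
      ∀ β, (ι (g (β, i))).coeff m = 0 := by
    intro i m
    rw [hcoeff]
    constructor
    · intro h0 β
      have h1 : (fun β => (ι (g (β, i))).coeff m) = 0 :=
        hω.1 (h0.trans (by simp [zero_pow hq.ne']))
      exact congrFun h1 β
    · intro h0
      simp [h0, zero_pow hq.ne']
  constructor
  · rintro H ⟨β, i⟩ m hm
    exact (hzero i m).1 (H _ (by rwa [← hle])) β
  · intro H m hm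
    obtain ⟨i, m', rfl⟩ := exists_residueExponent_add hq m
    rw [← hle] at hm
    exact (hzero i m').2 fun β => H (β, i) m' hm

theorem card_residues_natCeil_div_eq {q : ℕ} (hq : 0 < q) (N k : ℕ) (dd c : Fin n → ℕ) :
    Fintype.card {b : Fin N × (Fin n → Fin q) //
        (fun j => (dd j * k - b.2 j + (q - 1)) / q) = c} =
      N * ∏ j, (q - ((c j : ℤ) * (q : ℤ) - (k : ℤ) * (dd j : ℤ)).natAbs) := by
  let E : {b : Fin N × (Fin n → Fin q) // (fun j => (dd j * k - b.2 j + (q - 1)) / q) = c} ≃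
      Fin N × ∀ j, {i : Fin q // (dd j * k - i + (q - 1)) / q = c j} :=
    { toFun := fun b => (b.1.1, fun j => ⟨b.1.2 j, congrFun b.2 j⟩)
      invFun := fun b => ⟨(b.1, fun j => b.2 j), funext fun j => (b.2 j).2⟩
      left_inv := fun _ => rfl
      right_inv := fun _ => rfl }
  rw [Fintype.card_congr E, Fintype.card_prod, Fintype.card_fin, Fintype.card_pi]
  simp_rw [card_natCeil_div_eq hq]
  push_cast
  simp_rw [mul_comm (k : ℤ)]

theorem monomialFrobDecomp_of_injective [Fact p.Prime] [CharP K p] {b e k : ℕ} (hι : Injective ι)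
    (hx : ∀ j, ι (x j) = MvPowerSeries.X j)
    (hC : ∀ a, ∃ s : S, ι s = MvPowerSeries.C a)
    (hrange : CoeffReindexClosed ι)
    (hω : ∃ ω : Fin (b ^ e) → K, IsPowBasis (p ^ e) ω)
    (dd : Fin n → ℕ) (hk : k ≤ p ^ e - 1) : MonomialFrobDecomp p b e k n S x dd := by
  classical
  have hq : 0 < p ^ e := pow_pos (Fact.out : p.Prime).pos e
  obtain ⟨ω, hω⟩ := hω
  obtain ⟨Φ, hΦsmul, hΦcoeff⟩ := exists_frobenius_coordinates hι hx hC hrange hω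
  let ceil (a : Fin (b ^ e) × (Fin n → Fin (p ^ e))) : Fin n → ℕ :=
    fun j => (dd j * k - a.2 j + (p ^ e - 1)) / p ^ e
  have hceil : ∀ a j, ceil a j ≤ dd j := by
    intro a j
    rw [natCeil_div_le_iff hq, mul_comm (dd j)]
    exact (Nat.mul_le_mul_right _ (hk.trans (Nat.sub_le _ _))).trans (Nat.le_add_left _ _)
  have hcard : ∀ c : {c : Fin n → ℕ // ∀ j, c j ≤ dd j}, Nonempty
      (Fin (b ^ e * ∏ j, (p ^ e -
        ((c.1 j : ℤ) * (p ^ e : ℤ) - (k : ℤ) * (dd j : ℤ)).natAbs)) ≃ {a // ceil a = c.1}) := by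
    intro c
    refine ⟨(Fintype.equivFinOfCardEq ?_).symm⟩
    have := card_residues_natCeil_div_eq hq (b ^ e) k dd c.1
    push_cast at this
    exact this
  let ε := fun c => (hcard c).some
  have : Finite {c : Fin n → ℕ // ∀ j, c j ≤ dd j} :=
    (Set.finite_Iic dd).subset fun c hc => hc
  have := Fintype.ofFinite {c : Fin n → ℕ // ∀ j, c j ≤ dd j}
  unfold MonomialFrobDecomp
  let D := DirectSum.linearEquivFunOnFintype S {c : Fin n → ℕ // ∀ j, c j ≤ dd j} fun c =>
    Fin (b ^ e * ∏ j, (p ^ e - ((c.1 j : ℤ) * (p ^ e : ℤ) - (k : ℤ) * (dd j : ℤ)).natAbs)) →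
        S ⧸ Ideal.span {∏ j, x j ^ c.1 j}
  let θ := D.symm.toLinearMap.toAddMonoidHom.comp (AddMonoidHom.mk' (fun h c t =>
    Ideal.Quotient.mk (Ideal.span {∏ j, x j ^ c.1 j}) (Φ.symm h (ε c t).1)) fun h h' => by
      funext c t
      simp only [map_add, Pi.add_apply])
  have hθ : ∀ h, D (θ h) = fun c t =>
      Ideal.Quotient.mk (Ideal.span {∏ j, x j ^ c.1 j}) (Φ.symm h (ε c t).1) := fun h =>
    D.apply_symm_apply _
  refine frobIso_quotient_of_surjective θ ?_ ?_ ?_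
  · intro y
    choose u hu using fun c t => Ideal.Quotient.mk_surjective (D y c t)
    refine ⟨Φ fun a => u ⟨ceil a, hceil a⟩ ((ε ⟨ceil a, hceil a⟩).symm ⟨a, rfl⟩),
      D.injective ?_⟩
    rw [hθ]
    funext c t
    rw [← hu c t, Φ.symm_apply_apply]
    congr 1
    have huε : ∀ a c (hc : ∀ j, c j ≤ dd j) (hac : ceil a = c),
        u ⟨ceil a, hceil a⟩ ((ε ⟨ceil a, hceil a⟩).symm ⟨a, rfl⟩) =
          u ⟨c, hc⟩ ((ε ⟨c, hc⟩).symm ⟨a, hac⟩) := by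
      rintro a c hc rfl
      rfl
    rw [huε _ c.1 c.2 (ε c t).2]
    exact congrArg (u c) ((ε c).symm_apply_apply t)
  · intro h
    have hpow : (∏ j, x j ^ dd j) ^ k = ∏ j, x j ^ (dd j * k) := by
      rw [← Finset.prod_pow]
      simp_rw [pow_mul]
    rw [← D.map_eq_zero_iff, hθ, hpow, mem_span_prod_pow_iff_coordinates hι hx hrange hω
      (g := Φ.symm h) (fun i m => by rw [← hΦcoeff, Φ.apply_symm_apply])]
    constructor
    · intro H a
      have := congrFun (congrFun H ⟨ceil a, hceil a⟩) ((ε ⟨ceil a, hceil a⟩).symm ⟨a, rfl⟩)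
      rw [Equiv.apply_symm_apply] at this
      exact Ideal.Quotient.eq_zero_iff_mem.1 this
    · intro H
      funext c t
      refine Ideal.Quotient.eq_zero_iff_mem.2 ?_
      have hspan : Ideal.span {∏ j, x j ^ ceil (ε c t).1 j} =
          Ideal.span {∏ j, x j ^ c.1 j} := by rw [(ε c t).2]
      exact hspan.le (H (ε c t).1)
  · intro r h
    apply D.injective
    have hsymm : Φ.symm (r ^ p ^ e * h) = r • Φ.symm h := by
      rw [AddEquiv.symm_apply_eq, hΦsmul, Φ.apply_symm_apply]
    rw [map_smul, hθ, hθ, hsymm]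
    rfl

end Embedding

end FrobeniusDecomposition

theorem statement13 (p n b e k : ℕ) [Fact p.Prime]
    (K : Type) [Field K] [CharP K p]
    -- `b = [K : Kᵖ] < ∞`
    (hKfin : Module.Finite K (FStar K p 1 K))
    (hb : Module.finrank K (FStar K p 1 K) = b)
    (dd : Fin n → ℕ) (he : 1 ≤ e)
    -- `q = pᵉ > max {d₁,…,dₙ} + 1`
    (hq : ∀ j, dd j + 1 < p ^ e)
    (hk : 1 ≤ k) (hk' : k ≤ p ^ e - 1) :
    -- the decomposition holds both for `S = K[x₁,…,xₙ]` and for `S = K⟦x₁,…,xₙ⟧`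
    MonomialFrobDecomp p b e k n (MvPolynomial (Fin n) K)
      (fun i => MvPolynomial.X i) dd ∧
    MonomialFrobDecomp p b e k n (MvPowerSeries (Fin n) K)
      (fun i => MvPowerSeries.X i) dd := by
  have hω : ∃ ω : Fin (b ^ e) → K, IsPowBasis (p ^ e) ω := hb ▸ exists_isPowBasis hKfin e
  constructor
  · refine monomialFrobDecomp_of_injective (ι := MvPolynomial.coeToMvPowerSeries.ringHom)
      (MvPolynomial.coe_injective _ _) (fun j => MvPolynomial.coe_X j)
      (fun a => ⟨MvPolynomial.C a, MvPolynomial.coe_C a⟩) ?_ hω dd hk'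
    intro h φ hφ τ hτ
    refine ⟨∑ m ∈ h.support.preimage τ hτ.injOn,
      MvPolynomial.monomial m (φ (MvPolynomial.coeff (τ m) h)), fun m => ?_⟩
    simp only [MvPolynomial.coeToMvPowerSeries.ringHom_apply, MvPolynomial.coeff_coe,
      MvPolynomial.coeff_sum, MvPolynomial.coeff_monomial, Finset.sum_ite_eq']
    split_ifs with h0
    · rfl
    · rw [Finset.mem_preimage, MvPolynomial.notMem_support_iff] at h0
      rw [h0, hφ]
  · refine monomialFrobDecomp_of_injective (ι := RingHom.id (MvPowerSeries (Fin n) K))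
      Function.injective_id (fun j => rfl) (fun a => ⟨MvPowerSeries.C a, rfl⟩) ?_ hω dd hk'
    intro h φ _ τ _
    exact ⟨fun m => φ (h.coeff (τ m)), fun m => rfl⟩
end

section
/- Let K be a field of prime characteristic p with [K:K^p] < ∞ and let S be either K[x_1,…,x_n] or K[[x_1,…,x_n]]. For 1 ≤ j ≤ t let f_j = x_1^{d_{1,j}} ⋯ x_n^{d_{n,j}} be a monomial, let G_j be the (finite) set of monomials x_1^{m_1} ⋯ x_n^{m_n} with 0 ≤ m_i ≤ d_{i,j} for all i, and let 𝔍 be the (finite) set of ideals of the form (g_1,…,g_t) with g_j ∈ G_j for each j. Set I = (f_1,…,f_t) and R = S/I. Then for every e ≥ 1 there exist nonnegative integers α_e(J) for J ∈ 𝔍 such that F_*^e(R) ≅ ⨁_{J ∈ 𝔍} (S/J)^{⊕ α_e(J)} as S-modules, with the convention that (S/J)^{⊕0} = 0. -/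
open scoped DirectSum

universe u v w

/-- The decomposition of `F_*ᵉ (S/I)` for the monomial ideal
`I = (f₁, …, f_t)`, `f_j = x₁^{d 1 j} ⋯ xₙ^{d n j}` : there are multiplicities `α` such that
`F_*ᵉ (S/I) ≅ ⨁_{J ∈ 𝔍} (S/J)^{α(J)}` as `S`-modules, where `𝔍` runs over the ideals
generated by choices `g_j = x₁^{m 1 j} ⋯ xₙ^{m n j}` with `m i j ≤ d i j`. -/
def MonomialIdealFrobDecomp (p e n t : ℕ) (S : Type u) [CommRing S] (x : Fin n → S)
    (d : Fin t → Fin n → ℕ) : Prop :=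
  ∃ α : {m : Fin t → Fin n → ℕ // ∀ j i, m j i ≤ d j i} → ℕ,
    FrobIso S (p ^ e) (S ⧸ Ideal.span (Set.range fun j => ∏ i, x i ^ d j i))
      (⨁ m : {m : Fin t → Fin n → ℕ // ∀ j i, m j i ≤ d j i},
        Fin (α m) → S ⧸ Ideal.span (Set.range fun j => ∏ i, x i ^ m.1 j i))

/-- The additive map `(s_{a,l}) ↦ ∑ s_{a,l} ^ pᵉ * (b_l * x ^ a)`, where `a` runs over the exponent
vectors with entries smaller than `pᵉ`. -/
noncomputable def frobSum (p e : ℕ) {n : ℕ} {S Λ : Type*} [CommRing S] [ExpChar S p] [Fintype Λ]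
    (x : Fin n → S) (b : Λ → S) : ((Fin n → Fin (p ^ e)) × Λ → S) →+ S where
  toFun s := ∑ i, s i ^ p ^ e * (b i.2 * ∏ k, x k ^ (i.1 k : ℕ))
  map_zero' := by
    have := (expChar_pos S p).ne'
    simp [this]
  map_add' s s' := by
    simp only [Pi.add_apply, add_pow_expChar_pow, add_mul, Finset.sum_add_distrib]

theorem frobSum_apply (p e : ℕ) {n : ℕ} {S Λ : Type*} [CommRing S] [ExpChar S p] [Fintype Λ]
    (x : Fin n → S) (b : Λ → S) (s : (Fin n → Fin (p ^ e)) × Λ → S) :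
    frobSum p e x b s = ∑ i, s i ^ p ^ e * (b i.2 * ∏ k, x k ^ (i.1 k : ℕ)) := rfl

theorem frobSum_single (p e : ℕ) {n : ℕ} {S Λ : Type*} [CommRing S] [ExpChar S p] [Fintype Λ]
    [DecidableEq Λ] (x : Fin n → S) (b : Λ → S) (i : (Fin n → Fin (p ^ e)) × Λ) (r : S) :
    frobSum p e x b (Pi.single i r) = r ^ p ^ e * (b i.2 * ∏ k, x k ^ (i.1 k : ℕ)) := by
  have := (expChar_pos S p).ne'
  rw [frobSum_apply, Finset.sum_eq_single i]
  · simp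
  · intro j _ hj
    simp [Pi.single_eq_of_ne hj, this]
  · simp

theorem frobSum_smul (p e : ℕ) {n : ℕ} {S Λ : Type*} [CommRing S] [ExpChar S p] [Fintype Λ]
    (x : Fin n → S) (b : Λ → S) (s : (Fin n → Fin (p ^ e)) × Λ → S) (r : S) :
    frobSum p e x b (r • s) = r ^ p ^ e * frobSum p e x b s := by
  simp only [frobSum_apply, Finset.mul_sum, Pi.smul_apply, smul_eq_mul, mul_pow, mul_assoc]

/-- An element lies in the monomial ideal `(x ^ d_j)` iff each of its coordinates at the basis
elements `b_l * x ^ a` lies in the ideal generated by the `x ^ ⌈(d_j - a) / pᵉ⌉`. -/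
theorem frobSum_mem_span_iff (p e : ℕ) {n t : ℕ} {S Λ : Type*} [CommRing S] [ExpChar S p]
    [Fintype Λ] (x : Fin n → S) (b : Λ → S) (hb : Function.Bijective (frobSum p e x b))
    (d : Fin t → Fin n → ℕ) (s : (Fin n → Fin (p ^ e)) × Λ → S) :
    frobSum p e x b s ∈ Ideal.span (Set.range fun j => ∏ i, x i ^ d j i) ↔
      ∀ i, s i ∈ Ideal.span
        (Set.range fun j => ∏ k, x k ^ ((d j k - (i.1 k : ℕ)) ⌈/⌉ (p ^ e))) := by
  classical
  have hq : 0 < p ^ e := pow_pos (expChar_pos S p) e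
  constructor
  · intro h
    let T : AddSubgroup S :=
      (AddSubgroup.pi Set.univ fun i : (Fin n → Fin (p ^ e)) × Λ =>
        (Ideal.span (Set.range fun j => ∏ k, x k ^ ((d j k - (i.1 k : ℕ)) ⌈/⌉ (p ^ e)))
          ).toAddSubgroup).map (frobSum p e x b)
    suffices hT : frobSum p e x b s ∈ T by
      obtain ⟨s', hs', hss⟩ := hT
      rw [← hb.1 hss]
      intro i
      exact hs' i (Set.mem_univ i)
    obtain ⟨c, hc⟩ := Ideal.mem_span_range_iff_exists_fun.1 h
    rw [← hc]
    refine sum_mem fun j _ => ?_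
    obtain ⟨u, hu⟩ := hb.2 (c j)
    rw [← hu, frobSum_apply, Finset.sum_mul]
    refine sum_mem fun i _ => ?_
    let a' : Fin n → Fin (p ^ e) := fun k => ⟨(d j k + i.1 k) % p ^ e, Nat.mod_lt _ hq⟩
    let v : S := u i * ∏ k, x k ^ ((d j k + i.1 k) / p ^ e)
    refine ⟨Pi.single (a', i.2) v, ?_, ?_⟩
    · intro i' _
      rcases eq_or_ne i' (a', i.2) with rfl | hi
      · rw [Pi.single_eq_same]
        refine Ideal.mul_mem_left _ _ (Ideal.mem_of_dvd _ ?_ (Ideal.subset_span ⟨j, rfl⟩))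
        refine Finset.prod_dvd_prod_of_dvd _ _ fun k _ => pow_dvd_pow _ ?_
        rw [ceilDiv_le_iff_le_mul hq]
        have := Nat.div_add_mod (d j k + i.1 k) (p ^ e)
        simp only [a']
        omega
      · rw [Pi.single_eq_of_ne hi]
        exact Ideal.zero_mem _
    · rw [frobSum_single]
      have key : (∏ k, x k ^ ((d j k + i.1 k) / p ^ e)) ^ p ^ e * ∏ k, x k ^ (a' k : ℕ) =
          (∏ k, x k ^ (i.1 k : ℕ)) * ∏ k, x k ^ d j k := by
        rw [← Finset.prod_pow, ← Finset.prod_mul_distrib, ← Finset.prod_mul_distrib]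
        refine Finset.prod_congr rfl fun k _ => ?_
        rw [← pow_mul, ← pow_add, ← pow_add, mul_comm, Nat.div_add_mod, add_comm]
      simp only [v, mul_pow]
      linear_combination (u i ^ p ^ e * b i.2) * key
  · intro h
    rw [frobSum_apply]
    refine sum_mem fun i _ => ?_
    obtain ⟨c, hc⟩ := Ideal.mem_span_range_iff_exists_fun.1 (h i)
    rw [← hc, sum_pow_char_pow, Finset.sum_mul]
    refine sum_mem fun j _ => ?_
    refine Ideal.mem_of_dvd _ ?_ (Ideal.subset_span ⟨j, rfl⟩)
    have key : (∏ k, x k ^ d j k) ∣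
        (∏ k, x k ^ ((d j k - (i.1 k : ℕ)) ⌈/⌉ (p ^ e))) ^ p ^ e * ∏ k, x k ^ (i.1 k : ℕ) := by
      rw [← Finset.prod_pow, ← Finset.prod_mul_distrib]
      refine Finset.prod_dvd_prod_of_dvd _ _ fun k _ => ?_
      rw [← pow_mul, ← pow_add]
      refine pow_dvd_pow _ ?_
      have := (ceilDiv_le_iff_le_mul hq).1 (le_refl ((d j k - (i.1 k : ℕ)) ⌈/⌉ (p ^ e)))
      rw [mul_comm] at this
      omega
    rw [mul_pow]
    refine key.trans ⟨c j ^ p ^ e * b i.2, by ring⟩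

theorem monomialIdealFrobDecomp_of_bijective (p e n t : ℕ) {S : Type u} {Λ : Type*} [CommRing S]
    [ExpChar S p] [Fintype Λ] (x : Fin n → S) (b : Λ → S)
    (hb : Function.Bijective (frobSum p e x b)) (d : Fin t → Fin n → ℕ) :
    MonomialIdealFrobDecomp p e n t S x d := by
  classical
  have hq : 0 < p ^ e := pow_pos (expChar_pos S p) e
  have : Finite {m : Fin t → Fin n → ℕ // ∀ j i, m j i ≤ d j i} :=
    (Set.finite_Iic d).subset fun m hm => hm
  have := Fintype.ofFinite {m : Fin t → Fin n → ℕ // ∀ j i, m j i ≤ d j i}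
  let c : (Fin n → Fin (p ^ e)) × Λ → {m : Fin t → Fin n → ℕ // ∀ j i, m j i ≤ d j i} := fun i =>
    ⟨fun j k => (d j k - (i.1 k : ℕ)) ⌈/⌉ (p ^ e), fun j k => by
      rw [ceilDiv_le_iff_le_mul hq]
      exact (Nat.sub_le _ _).trans (Nat.le_mul_of_pos_left _ hq)⟩
  let ε : (Σ m, Fin (Fintype.card {i // c i = m})) ≃ (Fin n → Fin (p ^ e)) × Λ :=
    (Equiv.sigmaCongrRight fun m => (Fintype.equivFin {i // c i = m}).symm).trans
      (Equiv.sigmaFiberEquiv c)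
  have hε : ∀ m k, c (ε ⟨m, k⟩) = m := fun m k =>
    ((Fintype.equivFin {i // c i = m}).symm k).2
  refine ⟨fun m => Fintype.card {i // c i = m}, ?_⟩
  let J : {m : Fin t → Fin n → ℕ // ∀ j i, m j i ≤ d j i} → Ideal S :=
    fun m => Ideal.span (Set.range fun j => ∏ i, x i ^ m.1 j i)
  let Φ : ((Fin n → Fin (p ^ e)) × Λ → S) ≃+ S := AddEquiv.ofBijective (frobSum p e x b) hb
  have hΦ : ∀ s, Φ s = frobSum p e x b s := fun s => rfl
  let Ψ : S →+ (∀ m, Fin (Fintype.card {i // c i = m}) → S ⧸ J m) :=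
    { toFun := fun y m k => Ideal.Quotient.mk (J m) (Φ.symm y (ε ⟨m, k⟩))
      map_zero' := by ext; simp
      map_add' := fun y z => by ext; simp }
  have hΨ : ∀ y m k, Ψ y m k = Ideal.Quotient.mk (J m) (Φ.symm y (ε ⟨m, k⟩)) := fun _ _ _ => rfl
  have hΨsurj : Function.Surjective Ψ := by
    intro w
    choose z hz using fun m k => Ideal.Quotient.mk_surjective (w m k)
    refine ⟨Φ fun i => z (ε.symm i).1 (ε.symm i).2, ?_⟩
    ext m k
    rw [hΨ, AddEquiv.symm_apply_apply, Equiv.symm_apply_apply, hz]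
  have hker : Ψ.ker = (Ideal.span (Set.range fun j => ∏ i, x i ^ d j i)).toAddSubgroup := by
    ext y
    obtain ⟨s, rfl⟩ := Φ.surjective y
    rw [AddMonoidHom.mem_ker, Submodule.mem_toAddSubgroup, hΦ,
      frobSum_mem_span_iff p e x b hb d s, ← hΦ]
    have hJ : ∀ i, (Ideal.span
        (Set.range fun j => ∏ k, x k ^ ((d j k - (i.1 k : ℕ)) ⌈/⌉ (p ^ e)))) = J (c i) :=
      fun i => rfl
    simp only [hJ]
    rw [← ε.forall_congr_right]
    constructor
    · rintro h ⟨m, k⟩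
      have h1 := congrFun (congrFun h m) k
      rw [hΨ, AddEquiv.symm_apply_apply] at h1
      rw [hε]
      exact Ideal.Quotient.eq_zero_iff_mem.1 h1
    · intro h
      ext m k
      have h1 := h ⟨m, k⟩
      rw [hε] at h1
      rw [hΨ, AddEquiv.symm_apply_apply]
      exact Ideal.Quotient.eq_zero_iff_mem.2 h1
  let g₁ : (S ⧸ Ideal.span (Set.range fun j => ∏ i, x i ^ d j i)) ≃+
      (∀ m, Fin (Fintype.card {i // c i = m}) → S ⧸ J m) :=
    (QuotientAddGroup.quotientAddEquivOfEq hker.symm).trans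
      (QuotientAddGroup.quotientKerEquivOfSurjective Ψ hΨsurj)
  have hg₁ : ∀ y : S, g₁ (Ideal.Quotient.mk _ y) = Ψ y := fun y => rfl
  let g₂ := DirectSum.linearEquivFunOnFintype S
    {m : Fin t → Fin n → ℕ // ∀ j i, m j i ≤ d j i}
    (fun m => Fin (Fintype.card {i // c i = m}) → S ⧸ J m)
  refine ⟨g₁.trans g₂.symm.toAddEquiv, fun r y => ?_⟩
  obtain ⟨y, rfl⟩ := Ideal.Quotient.mk_surjective y
  change g₂.symm (g₁ (Ideal.Quotient.mk _ (r ^ p ^ e * y))) =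
    r • g₂.symm (g₁ (Ideal.Quotient.mk _ y))
  rw [hg₁, hg₁, ← map_smul]
  congr 1
  obtain ⟨s, rfl⟩ := Φ.surjective y
  ext m k
  have h1 : r ^ p ^ e * Φ s = Φ (r • s) := (frobSum_smul p e x b s r).symm
  rw [h1, hΨ, Pi.smul_apply, Pi.smul_apply, hΨ, AddEquiv.symm_apply_apply,
    AddEquiv.symm_apply_apply]
  rfl

theorem RingHom.Finite.exists_bijective_sum_mul {A B : Type*} [Field A] [CommRing B]
    {φ : A →+* B} (hφ : φ.Finite) :
    ∃ (L : ℕ) (b : Fin L → B), Function.Bijective fun s : Fin L → A => ∑ l, φ (s l) * b l := by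
  algebraize [φ]
  refine ⟨_, Module.finBasis A B, ?_⟩
  convert (Module.finBasis A B).equivFun.symm.bijective using 1
  ext s
  simp [Module.Basis.equivFun_symm_apply, Algebra.smul_def, RingHom.algebraMap_toAlgebra]

/-- If `K` is finite over `Kᵖ`, then it has a finite basis over `K ^ pᵉ`. -/
theorem exists_bijective_sum_pow_mul (p : ℕ) [Fact p.Prime] (K : Type*) [Field K] [CharP K p]
    (hKfin : Module.Finite K (FStar K p 1 K)) (e : ℕ) :
    ∃ (L : ℕ) (b : Fin L → K),
      Function.Bijective fun s : Fin L → K => ∑ l, s l ^ p ^ e * b l := by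
  have : ExpChar K p := .prime Fact.out
  have h1 : (iterateFrobenius K p 1).Finite := hKfin
  have he : (iterateFrobenius K p e).Finite := by
    induction e with
    | zero =>
      rw [iterateFrobenius_zero]
      exact RingHom.Finite.id K
    | succ e ih =>
      have : iterateFrobenius K p (e + 1) =
          (iterateFrobenius K p e).comp (iterateFrobenius K p 1) := by
        ext y
        exact iterateFrobenius_add_apply K p e 1 y
      rw [this]
      exact ih.comp h1
  exact he.exists_bijective_sum_mul

theorem MvPowerSeries.C_mul_prod_X_pow {n : ℕ} {K : Type*} [CommRing K] (c : K)
    (a : Fin n →₀ ℕ) :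
    (C c * ∏ k, X k ^ a k : MvPowerSeries (Fin n) K) = monomial a c := by
  rw [monomial_eq', Finsupp.prod_fintype _ _ (by simp)]

theorem MvPowerSeries.coeff_pow_mul_monomial_s14 (p e : ℕ) {n : ℕ} {K : Type*} [CommRing K]
    [ExpChar K p] (f : MvPowerSeries (Fin n) K) (b : K) (m : Fin n →₀ ℕ)
    (r a : Fin n → Fin (p ^ e)) :
    coeff (p ^ e • m + Finsupp.equivFunOnFinite.symm fun k => (r k : ℕ))
      (f ^ p ^ e * (C b * ∏ k, X k ^ (a k : ℕ))) =
      if a = r then coeff m f ^ p ^ e * b else 0 := by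
  have hp : p ≠ 0 := (expChar_pos K p).ne'
  have h := C_mul_prod_X_pow b (Finsupp.equivFunOnFinite.symm fun k => (a k : ℕ))
  simp only [Finsupp.equivFunOnFinite_symm_apply_apply] at h
  rw [h, ← map_iterateFrobenius_expand p hp, coeff_mul_monomial, coeff_map]
  split_ifs with h1 h2 h2
  · subst h2
    rw [add_tsub_cancel_right, coeff_expand_smul]
    rfl
  · obtain ⟨k, hk⟩ := Function.ne_iff.1 h2
    rw [coeff_expand_of_not_dvd (i := k), map_zero, zero_mul]
    intro hdvd
    apply hk
    have hle := h1 k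
    simp only [Finsupp.coe_add, Finsupp.coe_smul, Pi.add_apply, Pi.smul_apply, smul_eq_mul,
      Finsupp.equivFunOnFinite_symm_apply_apply, Finsupp.coe_tsub, Pi.sub_apply] at hle hdvd
    have := (Nat.modEq_iff_dvd' hle).2 hdvd
    have h3 : (a k : ℕ) % p ^ e = (r k : ℕ) % p ^ e := by
      rw [this, Nat.mul_add_mod]
    rw [Nat.mod_eq_of_lt (a k).2, Nat.mod_eq_of_lt (r k).2] at h3
    exact Fin.ext h3
  · subst h2
    exact absurd le_add_self h1
  · rfl

theorem MvPowerSeries.coeff_frobSum (p e : ℕ) {n : ℕ} {K Λ : Type*} [CommRing K] [ExpChar K p]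
    [ExpChar (MvPowerSeries (Fin n) K) p] [Fintype Λ] (b : Λ → K)
    (s : (Fin n → Fin (p ^ e)) × Λ → MvPowerSeries (Fin n) K) (m : Fin n →₀ ℕ)
    (r : Fin n → Fin (p ^ e)) :
    coeff (p ^ e • m + Finsupp.equivFunOnFinite.symm fun k => (r k : ℕ))
      (frobSum p e X (fun l => C (b l)) s) = ∑ l, coeff m (s (r, l)) ^ p ^ e * b l := by
  rw [frobSum_apply, map_sum, Fintype.sum_prod_type, Finset.sum_eq_single r]
  · simp only [coeff_pow_mul_monomial_s14, if_true]
  · intro a _ ha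
    simp only [coeff_pow_mul_monomial_s14, if_neg ha, Finset.sum_const_zero]
  · simp

theorem Finsupp.exists_eq_smul_add_of_pos {n q : ℕ} (hq : 0 < q) (m : Fin n →₀ ℕ) :
    ∃ (c : Fin n →₀ ℕ) (r : Fin n → Fin q),
      m = q • c + Finsupp.equivFunOnFinite.symm fun k => (r k : ℕ) := by
  refine ⟨Finsupp.equivFunOnFinite.symm fun k => m k / q, fun k => ⟨m k % q, Nat.mod_lt _ hq⟩, ?_⟩
  ext k
  simp [Nat.div_add_mod]

theorem MvPowerSeries.frobSum_bijective (p e : ℕ) {n : ℕ} {K Λ : Type*} [CommRing K] [ExpChar K p]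
    [ExpChar (MvPowerSeries (Fin n) K) p] [Fintype Λ] (b : Λ → K)
    (hb : Function.Bijective fun s : Λ → K => ∑ l, s l ^ p ^ e * b l) :
    Function.Bijective (frobSum p e (X : Fin n → MvPowerSeries (Fin n) K) fun l => C (b l)) := by
  have hq : 0 < p ^ e := pow_pos (expChar_pos K p) e
  constructor
  · intro s s' h
    ext ⟨r, l⟩ m
    have h1 := congrArg
      (coeff (p ^ e • m + Finsupp.equivFunOnFinite.symm fun k => (r k : ℕ))) h
    rw [coeff_frobSum, coeff_frobSum] at h1
    exact congrFun (hb.1 (a₁ := fun l => coeff m (s (r, l)))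
      (a₂ := fun l => coeff m (s' (r, l))) h1) l
  · intro y
    choose z hz using fun v => hb.2 v
    refine ⟨fun i m => z (coeff (p ^ e • m +
      Finsupp.equivFunOnFinite.symm fun k => (i.1 k : ℕ)) y) i.2, ?_⟩
    ext m
    obtain ⟨c, r, rfl⟩ := Finsupp.exists_eq_smul_add_of_pos hq m
    refine (coeff_frobSum p e b _ c r).trans ?_
    simp only
    exact hz _

theorem MvPolynomial.coe_frobSum (p e : ℕ) {n : ℕ} {K Λ : Type*} [CommRing K]
    [ExpChar (MvPolynomial (Fin n) K) p] [ExpChar (MvPowerSeries (Fin n) K) p] [Fintype Λ]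
    (b : Λ → K) (s : (Fin n → Fin (p ^ e)) × Λ → MvPolynomial (Fin n) K) :
    (frobSum p e X (fun l => C (b l)) s : MvPowerSeries (Fin n) K) =
      frobSum p e MvPowerSeries.X (fun l => MvPowerSeries.C (b l)) fun i =>
        (s i : MvPowerSeries (Fin n) K) := by
  simp only [frobSum_apply, ← coeToMvPowerSeries.ringHom_apply, map_sum, map_mul, map_prod, map_pow]
  simp only [coeToMvPowerSeries.ringHom_apply, coe_X, coe_C]

theorem MvPolynomial.frobSum_bijective (p e : ℕ) {n : ℕ} {K Λ : Type*} [CommRing K] [ExpChar K p]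
    [ExpChar (MvPolynomial (Fin n) K) p] [ExpChar (MvPowerSeries (Fin n) K) p] [Fintype Λ]
    (b : Λ → K) (hb : Function.Bijective fun s : Λ → K => ∑ l, s l ^ p ^ e * b l) :
    Function.Bijective (frobSum p e (X : Fin n → MvPolynomial (Fin n) K) fun l => C (b l)) := by
  classical
  have hq : 0 < p ^ e := pow_pos (expChar_pos K p) e
  constructor
  · intro s s' h
    have h1 := congrArg (fun f : MvPolynomial (Fin n) K => (f : MvPowerSeries (Fin n) K)) h
    simp only [coe_frobSum] at h1
    ext1 i
    exact coe_injective _ _ (congrFun ((MvPowerSeries.frobSum_bijective p e b hb).1 h1) i)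
  · rw [← AddMonoidHom.range_eq_top, eq_top_iff]
    intro y _
    induction y using MvPolynomial.induction_on' with
    | add f g hf hg => exact add_mem (hf trivial) (hg trivial)
    | monomial m v =>
      obtain ⟨c, r, rfl⟩ := Finsupp.exists_eq_smul_add_of_pos hq m
      obtain ⟨z, rfl⟩ := hb.2 v
      simp only [map_sum]
      refine sum_mem fun l _ => ⟨Pi.single (r, l) (monomial c (z l)), ?_⟩
      rw [frobSum_single, monomial_pow]
      have h := monomial_eq (s := Finsupp.equivFunOnFinite.symm fun k => (r k : ℕ)) (a := b l)
      rw [Finsupp.prod_fintype _ _ (by simp)] at h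
      simp only [Finsupp.equivFunOnFinite_symm_apply_apply] at h
      rw [← h, monomial_mul]

theorem statement14 (p n t e : ℕ) [Fact p.Prime]
    (K : Type) [Field K] [CharP K p]
    -- `[K : Kᵖ] < ∞`
    (hKfin : Module.Finite K (FStar K p 1 K))
    (d : Fin t → Fin n → ℕ) (he : 1 ≤ e) :
    -- the decomposition holds both for `S = K[x₁,…,xₙ]` and for `S = K⟦x₁,…,xₙ⟧`
    MonomialIdealFrobDecomp p e n t (MvPolynomial (Fin n) K)
      (fun i => MvPolynomial.X i) d ∧
    MonomialIdealFrobDecomp p e n t (MvPowerSeries (Fin n) K)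
      (fun i => MvPowerSeries.X i) d := by
  have : ExpChar K p := .prime Fact.out
  have : ExpChar (MvPowerSeries (Fin n) K) p :=
    expChar_of_injective_algebraMap (R := K) (FaithfulSMul.algebraMap_injective _ _) p
  obtain ⟨L, b, hb⟩ := exists_bijective_sum_pow_mul p K hKfin e
  exact ⟨monomialIdealFrobDecomp_of_bijective p e n t _ _
      (MvPolynomial.frobSum_bijective p e b hb) d,
    monomialIdealFrobDecomp_of_bijective p e n t _ _
      (MvPowerSeries.frobSum_bijective p e b hb) d⟩
end

section
/- Let (R,m) be a Noetherian local ring, let A be an s×s matrix and B a t×t matrix over R, all of whose entries lie in m, and suppose the R-linear maps A : R^s → R^s and B : R^t → R^t (given by matrix multiplication) are injective. If Cok(A) is isomorphic to Cok(B) as R-modules, then s = t and A is equivalent to B, i.e. there exist invertible matrices U, V ∈ M_s(R) with A = U B V. -/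
universe u

namespace Matrix

variable {R : Type*} [CommRing R]

theorem exists_eq_mul_of_range_le {l m n : Type*} [Fintype m] [Fintype n] [DecidableEq n]
    {A : Matrix l n R} {B : Matrix l m R}
    (h : LinearMap.range A.mulVecLin ≤ LinearMap.range B.mulVecLin) :
    ∃ C : Matrix m n R, A = B * C := by
  have h' : ∀ j, ∃ c, B *ᵥ c = A.col j := fun j => by
    obtain ⟨c, hc⟩ := h ⟨Pi.single j 1, rfl⟩
    exact ⟨c, by simpa using hc⟩
  choose c hc using h'
  refine ⟨of fun i j => c j i, ?_⟩
  ext i j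
  exact (congrFun (hc j) i).symm

theorem exists_mk_mulVec_eq {m n : Type*} [Fintype n] [DecidableEq n]
    {M : Submodule R (n → R)} {N : Submodule R (m → R)} (f : ((n → R) ⧸ M) →ₗ[R] ((m → R) ⧸ N)) :
    ∃ P : Matrix m n R, ∀ x, (Submodule.Quotient.mk (P *ᵥ x) : (m → R) ⧸ N) =
      f (Submodule.Quotient.mk x) := by
  obtain ⟨g, hg⟩ := Module.projective_lifting_property N.mkQ (f ∘ₗ M.mkQ) N.mkQ_surjective
  refine ⟨LinearMap.toMatrix' g, fun x => ?_⟩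
  rw [LinearMap.toMatrix'_mulVec]
  exact LinearMap.congr_fun hg x

theorem isUnit_of_sub_one_mem_maximalIdeal [IsLocalRing R] {n : Type*} [Fintype n] [DecidableEq n]
    {M : Matrix n n R} (h : ∀ i j, (M - 1) i j ∈ IsLocalRing.maximalIdeal R) : IsUnit M := by
  rw [isUnit_iff_isUnit_det, ← isUnit_map_iff (IsLocalRing.residue R), RingHom.map_det]
  have h1 : (IsLocalRing.residue R).mapMatrix (M - 1) = 0 := by
    ext i j
    exact (IsLocalRing.residue_eq_zero_iff _).2 (h i j)
  rw [map_sub, sub_eq_zero, map_one] at h1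
  simp [h1]

/-- If the entries of `A` lie in the maximal ideal, a matrix inducing the identity on the cokernel
of `A` is invertible. -/
theorem isUnit_of_mk_mulVec_eq [IsLocalRing R] {n : Type*} [Fintype n] [DecidableEq n]
    {A M : Matrix n n R} (hA : ∀ i j, A i j ∈ IsLocalRing.maximalIdeal R)
    (h : ∀ x, (Submodule.Quotient.mk (M *ᵥ x) : (n → R) ⧸ LinearMap.range A.mulVecLin) =
      Submodule.Quotient.mk x) : IsUnit M := by
  obtain ⟨C, hC⟩ : ∃ C, M - 1 = A * C := by
    apply exists_eq_mul_of_range_le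
    rintro _ ⟨x, rfl⟩
    simpa [sub_mulVec] using (Submodule.Quotient.eq _).1 (h x)
  refine isUnit_of_sub_one_mem_maximalIdeal fun i j => ?_
  rw [hC, mul_apply]
  exact Ideal.sum_mem _ fun k _ => Ideal.mul_mem_right _ _ (hA i k)

theorem mulVec_injective_of_isUnit_mul {m n : Type*} [Fintype m] [Fintype n] [DecidableEq n]
    {P : Matrix m n R} {Q : Matrix n m R} (h : IsUnit (Q * P)) :
    Function.Injective P.mulVecLin := by
  intro x y hxy
  apply mulVec_injective_of_isUnit h
  simp only [mulVecLin_apply] at hxy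
  simp only [← mulVec_mulVec, hxy]

end Matrix

theorem statement15 (R : Type u) [CommRing R] [IsNoetherianRing R] [IsLocalRing R]
    (s t : ℕ) (A : Matrix (Fin s) (Fin s) R) (B : Matrix (Fin t) (Fin t) R)
    -- all entries of `A` and `B` lie in the maximal ideal
    (hA : ∀ i j, A i j ∈ IsLocalRing.maximalIdeal R)
    (hB : ∀ i j, B i j ∈ IsLocalRing.maximalIdeal R)
    -- the linear maps `A : Rˢ → Rˢ` and `B : Rᵗ → Rᵗ` are injective
    (hAinj : Function.Injective A.mulVecLin) (hBinj : Function.Injective B.mulVecLin)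
    -- `Cok A ≅ Cok B` as `R`-modules
    (hiso : Nonempty (((Fin s → R) ⧸ LinearMap.range A.mulVecLin) ≃ₗ[R]
      ((Fin t → R) ⧸ LinearMap.range B.mulVecLin))) :
    -- then `s = t` and `A = U B V` for invertible matrices `U, V`
    ∃ h : s = t, ∃ U V : Matrix (Fin t) (Fin t) R, IsUnit U ∧ IsUnit V ∧
      Matrix.reindex (finCongr h) (finCongr h) A = U * B * V := by
  obtain ⟨e⟩ := hiso
  obtain ⟨P, hP⟩ := Matrix.exists_mk_mulVec_eq e.toLinearMap
  obtain ⟨Q, hQ⟩ := Matrix.exists_mk_mulVec_eq e.symm.toLinearMap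
  simp only [LinearEquiv.coe_coe] at hP hQ
  have hQP : IsUnit (Q * P) := Matrix.isUnit_of_mk_mulVec_eq hA fun x => by
    rw [← Matrix.mulVec_mulVec, hQ, hP, e.symm_apply_apply]
  have hPQ : IsUnit (P * Q) := Matrix.isUnit_of_mk_mulVec_eq hB fun x => by
    rw [← Matrix.mulVec_mulVec, hP, hQ, e.apply_symm_apply]
  obtain rfl : s = t := le_antisymm
    (le_of_fin_injective R _ (Matrix.mulVec_injective_of_isUnit_mul hQP))
    (le_of_fin_injective R _ (Matrix.mulVec_injective_of_isUnit_mul hPQ))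
  have hPu : IsUnit P := by
    rw [Matrix.isUnit_iff_isUnit_det] at hPQ ⊢
    rw [Matrix.det_mul] at hPQ
    exact isUnit_of_mul_isUnit_left hPQ
  have hmem : ∀ x, P.mulVec x ∈ LinearMap.range B.mulVecLin ↔
      x ∈ LinearMap.range A.mulVecLin := fun x => by
    rw [← Submodule.Quotient.mk_eq_zero, hP, e.map_eq_zero_iff, Submodule.Quotient.mk_eq_zero]
  obtain ⟨V, hV⟩ : ∃ V, P * A = B * V := by
    apply Matrix.exists_eq_mul_of_range_le
    rintro _ ⟨x, rfl⟩
    rw [Matrix.mulVecLin_apply, ← Matrix.mulVec_mulVec]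
    exact (hmem _).2 ⟨x, rfl⟩
  obtain ⟨W, hW⟩ : ∃ W, B = P * A * W := by
    apply Matrix.exists_eq_mul_of_range_le
    intro y hy
    obtain ⟨x, rfl⟩ := Matrix.mulVec_surjective_iff_isUnit.2 hPu y
    obtain ⟨z, rfl⟩ := (hmem x).1 hy
    exact ⟨z, by simp⟩
  have hVW : V * W = 1 := by
    apply Matrix.mulVec_injective
    funext x
    apply hBinj
    simp only [Matrix.mulVecLin_apply, Matrix.mulVec_mulVec]
    rw [← Matrix.mul_assoc, ← hV, ← hW, Matrix.mul_one]
  refine ⟨rfl, P⁻¹, V, (Matrix.isUnit_nonsing_inv_iff).2 hPu,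
    IsUnit.of_mul_eq_one W hVW, ?_⟩
  rw [Matrix.mul_assoc, ← hV, Matrix.nonsing_inv_mul_cancel_left _ _
    ((Matrix.isUnit_iff_isUnit_det _).1 hPu)]
  rfl
end

section
/- Let (S,m) be a local domain and let f ∈ m be nonzero. Then every matrix factorization (φ,ψ) of f of size n is equivalent to a direct sum (α,β) ⊕ (f·I_t, I_t) ⊕ (I_r, f·I_r), where (α,β) is a matrix factorization of f all of whose entries lie in m (possibly of size 0) and t, r ≥ 0 with size(α) + t + r = n. -/
namespace Matrix

variable {R : Type*} [CommRing R]

/-- `(φ, ψ)` is a matrix factorization of `f`. -/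
def IsFactorization {ι : Type*} [Fintype ι] [DecidableEq ι] (f : R) (φ ψ : Matrix ι ι R) : Prop :=
  φ * ψ = f • (1 : Matrix ι ι R) ∧ ψ * φ = f • (1 : Matrix ι ι R)

/-- Equivalence of two pairs of square matrices, possibly over different index types. -/
def PairEquiv {ι κ : Type*} [Fintype ι] [DecidableEq ι] [Fintype κ] [DecidableEq κ]
    (φ ψ : Matrix ι ι R) (α β : Matrix κ κ R) : Prop :=
  ∃ (V : Matrix κ ι R) (V' : Matrix ι κ R) (W : Matrix κ ι R) (W' : Matrix ι κ R),
    V * V' = 1 ∧ V' * V = 1 ∧ W * W' = 1 ∧ W' * W = 1 ∧ V * φ = α * W ∧ W * ψ = β * V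

section PairEquiv

variable {ι κ μ : Type*} [Fintype ι] [DecidableEq ι] [Fintype κ] [DecidableEq κ]
  [Fintype μ] [DecidableEq μ] {f : R} {φ ψ : Matrix ι ι R} {α β : Matrix κ κ R}

theorem IsFactorization.symm (h : IsFactorization f φ ψ) : IsFactorization f ψ φ :=
  ⟨h.2, h.1⟩

theorem PairEquiv.swap (h : PairEquiv φ ψ α β) : PairEquiv ψ φ β α := by
  obtain ⟨V, V', W, W', h1, h2, h3, h4, h5, h6⟩ := h
  exact ⟨W, W', V, V', h3, h4, h1, h2, h6, h5⟩

theorem PairEquiv.trans {γ δ : Matrix μ μ R} (h : PairEquiv φ ψ α β) (h' : PairEquiv α β γ δ) :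
    PairEquiv φ ψ γ δ := by
  obtain ⟨V, V', W, W', h1, h2, h3, h4, h5, h6⟩ := h
  obtain ⟨X, X', Y, Y', k1, k2, k3, k4, k5, k6⟩ := h'
  have cancel {A : Matrix κ ι R} {A' : Matrix ι κ R} {B : Matrix μ κ R} {B' : Matrix κ μ R}
      (hA : A * A' = 1) (hB : B * B' = 1) : B * A * (A' * B') = 1 := by
    rw [Matrix.mul_assoc, ← Matrix.mul_assoc A, hA, Matrix.one_mul, hB]
  have cancel' {A : Matrix κ ι R} {A' : Matrix ι κ R} {B : Matrix μ κ R} {B' : Matrix κ μ R}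
      (hA : A' * A = 1) (hB : B' * B = 1) : A' * B' * (B * A) = 1 := by
    rw [Matrix.mul_assoc, ← Matrix.mul_assoc B', hB, Matrix.one_mul, hA]
  refine ⟨X * V, V' * X', Y * W, W' * Y', cancel h1 k1, cancel' h2 k2, cancel h3 k3,
    cancel' h4 k4, ?_, ?_⟩
  · rw [Matrix.mul_assoc, h5, ← Matrix.mul_assoc, k5, Matrix.mul_assoc]
  · rw [Matrix.mul_assoc, h6, ← Matrix.mul_assoc, k6, Matrix.mul_assoc]

theorem pairEquiv_submatrix (φ ψ : Matrix ι ι R) (e e' : κ ≃ ι) :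
    PairEquiv φ ψ (φ.submatrix e e') (ψ.submatrix e' e) := by
  refine ⟨(1 : Matrix ι ι R).submatrix e id, (1 : Matrix ι ι R).submatrix id e,
    (1 : Matrix ι ι R).submatrix e' id, (1 : Matrix ι ι R).submatrix id e', ?_, ?_, ?_, ?_, ?_, ?_⟩
  · rw [← submatrix_mul _ _ _ _ _ Function.bijective_id, Matrix.one_mul, submatrix_one_equiv]
  · rw [← submatrix_mul _ _ _ _ _ e.bijective, Matrix.one_mul, submatrix_id_id]
  · rw [← submatrix_mul _ _ _ _ _ Function.bijective_id, Matrix.one_mul, submatrix_one_equiv]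
  · rw [← submatrix_mul _ _ _ _ _ e'.bijective, Matrix.one_mul, submatrix_id_id]
  · rw [← submatrix_mul _ _ _ _ _ e'.bijective, Matrix.mul_one]
    nth_rw 1 [← submatrix_id_id φ]
    rw [← submatrix_mul _ _ _ _ _ Function.bijective_id, Matrix.one_mul]
  · rw [← submatrix_mul _ _ _ _ _ e.bijective, Matrix.mul_one]
    nth_rw 1 [← submatrix_id_id ψ]
    rw [← submatrix_mul _ _ _ _ _ Function.bijective_id, Matrix.one_mul]

theorem PairEquiv.fromBlocks_right (h : PairEquiv φ ψ α β) (γ δ : Matrix μ μ R) :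
    PairEquiv (fromBlocks φ 0 0 γ) (fromBlocks ψ 0 0 δ)
      (fromBlocks α 0 0 γ) (fromBlocks β 0 0 δ) := by
  obtain ⟨V, V', W, W', h1, h2, h3, h4, h5, h6⟩ := h
  refine ⟨fromBlocks V 0 0 1, fromBlocks V' 0 0 1, fromBlocks W 0 0 1, fromBlocks W' 0 0 1,
    ?_, ?_, ?_, ?_, ?_, ?_⟩ <;> simp [fromBlocks_multiply, *]

theorem PairEquiv.card_eq [Nontrivial R] (h : PairEquiv φ ψ α β) :
    Fintype.card κ = Fintype.card ι := by
  obtain ⟨V, V', -, -, h1, h2, -⟩ := h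
  simpa using (toLin'OfInv h1 h2).finrank_eq

/-- A matrix factorization can be transported along `V * φ = α * W` with `V`, `W` invertible. -/
theorem IsFactorization.exists_pairEquiv (h : IsFactorization f φ ψ) {V W : Matrix κ ι R}
    {V' W' : Matrix ι κ R} (hV : V * V' = 1) (hV' : V' * V = 1) (hW : W * W' = 1)
    (hW' : W' * W = 1) (hα : V * φ = α * W) :
    ∃ β, IsFactorization f α β ∧ PairEquiv φ ψ α β := by
  have hα' : α = V * φ * W' := by rw [hα, Matrix.mul_assoc, hW, Matrix.mul_one]
  refine ⟨W * ψ * V', ⟨?_, ?_⟩, V, V', W, W', hV, hV', hW, hW', hα, ?_⟩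
  · rw [← Matrix.mul_assoc, ← Matrix.mul_assoc, ← hα, Matrix.mul_assoc V, h.1]
    simp [hV]
  · rw [hα', Matrix.mul_assoc V, Matrix.mul_assoc, ← Matrix.mul_assoc V', hV', Matrix.one_mul,
      Matrix.mul_assoc, ← Matrix.mul_assoc ψ, h.2]
    simp [hW]
  · rw [Matrix.mul_assoc, hV', Matrix.mul_one]

/-- The Schur complement splits off an invertible lower right block. -/
theorem IsFactorization.exists_schur {φ ψ : Matrix (ι ⊕ κ) (ι ⊕ κ) R}
    (h : IsFactorization f φ ψ) (hu : IsUnit φ.toBlocks₂₂) :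
    ∃ α β : Matrix ι ι R, IsFactorization f α β ∧
      PairEquiv φ ψ (fromBlocks α 0 0 (1 : Matrix κ κ R))
        (fromBlocks β 0 0 (f • (1 : Matrix κ κ R))) := by
  obtain ⟨A, B, C, D, rfl⟩ : ∃ A B C D, φ = fromBlocks A B C D :=
    ⟨_, _, _, _, (fromBlocks_toBlocks φ).symm⟩
  rw [toBlocks_fromBlocks₂₂] at hu
  obtain ⟨D, rfl⟩ := hu
  set E : Matrix κ κ R := ((D⁻¹ : (Matrix κ κ R)ˣ) : Matrix κ κ R) with hE
  have hDE : (D : Matrix κ κ R) * E = 1 := D.mul_inv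
  have hED : E * (D : Matrix κ κ R) = 1 := D.inv_mul
  have hEC : (D : Matrix κ κ R) * (E * C) = C := by
    rw [← Matrix.mul_assoc, hDE, Matrix.one_mul]
  obtain ⟨X, hX, hXe⟩ := h.exists_pairEquiv (α := fromBlocks (A - B * E * C) 0 0 1)
    (V := fromBlocks 1 (-(B * E)) 0 E) (V' := fromBlocks 1 B 0 D)
    (W := fromBlocks 1 0 (E * C) 1) (W' := fromBlocks 1 0 (-(E * C)) 1)
    (by simp [fromBlocks_multiply, hED, Matrix.mul_assoc])
    (by simp [fromBlocks_multiply, hDE])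
    (by simp [fromBlocks_multiply])
    (by simp [fromBlocks_multiply])
    (by simp [fromBlocks_multiply, hED, Matrix.mul_assoc, sub_eq_add_neg])
  obtain ⟨P, Q, T, U, rfl⟩ : ∃ P Q T U, X = fromBlocks P Q T U :=
    ⟨_, _, _, _, (fromBlocks_toBlocks X).symm⟩
  obtain ⟨h1, h2⟩ := hX
  rw [← fromBlocks_one, fromBlocks_smul, fromBlocks_multiply, fromBlocks_inj] at h1 h2
  simp only [Matrix.zero_mul, Matrix.mul_zero, Matrix.one_mul, Matrix.mul_one, add_zero, zero_add,
    smul_zero] at h1 h2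
  obtain ⟨h11, -, rfl, rfl⟩ := h1
  obtain ⟨h21, rfl, -, -⟩ := h2
  exact ⟨_, P, ⟨h11, h21⟩, hXe⟩

end PairEquiv

section Local

variable {S : Type*} [CommRing S] [IsLocalRing S] {f : S}

/-- `(φ, ψ)` is equivalent to a reduced matrix factorization plus trivial ones. -/
def HasReducedSplitting {ι : Type*} [Fintype ι] [DecidableEq ι] (f : S) (φ ψ : Matrix ι ι S) :
    Prop :=
  ∃ (k t r : ℕ) (α β : Matrix (Fin k) (Fin k) S), IsFactorization f α β ∧
    (∀ i j, α i j ∈ IsLocalRing.maximalIdeal S ∧ β i j ∈ IsLocalRing.maximalIdeal S) ∧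
    PairEquiv φ ψ
      (fromBlocks α 0 0 (fromBlocks (f • (1 : Matrix (Fin t) (Fin t) S)) 0 0
        (1 : Matrix (Fin r) (Fin r) S)))
      (fromBlocks β 0 0 (fromBlocks (1 : Matrix (Fin t) (Fin t) S) 0 0
        (f • (1 : Matrix (Fin r) (Fin r) S))))

variable {ι κ : Type*} [Fintype ι] [DecidableEq ι] [Fintype κ] [DecidableEq κ]
  {φ ψ : Matrix ι ι S} {α β : Matrix κ κ S}

theorem HasReducedSplitting.of_pairEquiv (h : HasReducedSplitting f α β)
    (e : PairEquiv φ ψ α β) : HasReducedSplitting f φ ψ := by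
  obtain ⟨k, t, r, γ, δ, h1, h2, h3⟩ := h
  exact ⟨k, t, r, γ, δ, h1, h2, e.trans h3⟩

theorem HasReducedSplitting.swap (h : HasReducedSplitting f φ ψ) :
    HasReducedSplitting f ψ φ := by
  obtain ⟨k, t, r, γ, δ, h1, h2, h3⟩ := h
  refine ⟨k, r, t, δ, γ, h1.symm, fun i j => (h2 i j).symm, ?_⟩
  let e : Fin k ⊕ (Fin r ⊕ Fin t) ≃ Fin k ⊕ (Fin t ⊕ Fin r) :=
    (Equiv.refl _).sumCongr (Equiv.sumComm _ _)
  convert h3.swap.trans (pairEquiv_submatrix _ _ e e) using 1 <;>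
  · ext (i | i | i) (j | j | j) <;> rfl

theorem HasReducedSplitting.fromBlocks_one (h : HasReducedSplitting f φ ψ) :
    HasReducedSplitting f (fromBlocks φ 0 0 (1 : Matrix (Fin 1) (Fin 1) S))
      (fromBlocks ψ 0 0 (f • (1 : Matrix (Fin 1) (Fin 1) S))) := by
  obtain ⟨k, t, r, γ, δ, h1, h2, h3⟩ := h
  refine ⟨k, t, r + 1, γ, δ, h1, h2, ?_⟩
  let e₀ : Fin k ⊕ (Fin t ⊕ (Fin r ⊕ Fin 1)) ≃ (Fin k ⊕ (Fin t ⊕ Fin r)) ⊕ Fin 1 :=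
    ((Equiv.refl _).sumCongr (Equiv.sumAssoc _ _ _).symm).trans (Equiv.sumAssoc _ _ _).symm
  let e₁ : Fin k ⊕ (Fin t ⊕ Fin (r + 1)) ≃ Fin k ⊕ (Fin t ⊕ (Fin r ⊕ Fin 1)) :=
    (Equiv.refl _).sumCongr ((Equiv.refl _).sumCongr finSumFinEquiv.symm)
  have h₀ := (h3.fromBlocks_right (1 : Matrix (Fin 1) (Fin 1) S) (f • 1)).trans
    (pairEquiv_submatrix _ _ e₀ e₀)
  have hblocks (A : Matrix (Fin k) (Fin k) S) (a b : S) :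
      ((fromBlocks (fromBlocks A 0 0 (fromBlocks (a • (1 : Matrix (Fin t) (Fin t) S)) 0 0
        (b • (1 : Matrix (Fin r) (Fin r) S)))) 0 0
          (b • (1 : Matrix (Fin 1) (Fin 1) S))).submatrix e₀ e₀).submatrix e₁ e₁ =
      fromBlocks A 0 0 (fromBlocks (a • (1 : Matrix (Fin t) (Fin t) S)) 0 0
        (b • (1 : Matrix (Fin (r + 1)) (Fin (r + 1)) S))) := by
    have hassoc : (fromBlocks (fromBlocks A 0 0 (fromBlocks (a • (1 : Matrix (Fin t) (Fin t) S)) 0 0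
        (b • (1 : Matrix (Fin r) (Fin r) S)))) 0 0
          (b • (1 : Matrix (Fin 1) (Fin 1) S))).submatrix e₀ e₀ =
        fromBlocks A 0 0 (fromBlocks (a • (1 : Matrix (Fin t) (Fin t) S)) 0 0
          (b • (1 : Matrix (Fin r ⊕ Fin 1) (Fin r ⊕ Fin 1) S))) := by
      rw [← Matrix.fromBlocks_one (l := Fin r), fromBlocks_smul, smul_zero, smul_zero]
      ext (i | i | i | i) (j | j | j | j) <;> rfl
    rw [hassoc, ← submatrix_one_equiv (finSumFinEquiv (m := r) (n := 1)).symm]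
    ext (i | i | i) (j | j | j) <;> rfl
  have key := h₀.trans (pairEquiv_submatrix _ _ e₁ e₁)
  have hα := hblocks γ f 1
  have hβ := hblocks δ 1 f
  rw [one_smul, one_smul, one_smul] at hα
  rw [one_smul] at hβ
  rwa [hα, hβ] at key

theorem IsFactorization.hasReducedSplitting {n : ℕ} {φ ψ : Matrix (Fin n) (Fin n) S}
    (h : IsFactorization f φ ψ) : HasReducedSplitting f φ ψ := by
  induction n with
  | zero =>
    refine ⟨0, 0, 0, φ, ψ, h, fun i => i.elim0, ?_⟩
    convert pairEquiv_submatrix φ ψ (Equiv.equivOfIsEmpty (Fin 0 ⊕ (Fin 0 ⊕ Fin 0)) (Fin 0))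
      (Equiv.equivOfIsEmpty _ _) using 1 <;> exact Subsingleton.elim _ _
  | succ n ih =>
    have step {φ ψ : Matrix (Fin (n + 1)) (Fin (n + 1)) S} (h : IsFactorization f φ ψ)
        (i j : Fin (n + 1)) (hu : IsUnit (φ i j)) : HasReducedSplitting f φ ψ := by
      let e (i : Fin (n + 1)) : Fin n ⊕ Fin 1 ≃ Fin (n + 1) :=
        ((Equiv.refl _).sumCongr (Equiv.ofUnique (Fin 1) PUnit.{1})).trans
          ((Equiv.optionEquivSumPUnit _).symm.trans (finSuccEquiv' i).symm)
      have he (i : Fin (n + 1)) (x : Fin 1) : e i (Sum.inr x) = i := by simp [e]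
      have hsub : IsFactorization f (φ.submatrix (e i) (e j)) (ψ.submatrix (e j) (e i)) := by
        refine ⟨?_, ?_⟩
        · rw [← submatrix_mul _ _ _ _ _ (e j).bijective, h.1, submatrix_smul]
          simp
        · rw [← submatrix_mul _ _ _ _ _ (e i).bijective, h.2, submatrix_smul]
          simp
      have hunit : IsUnit (φ.submatrix (e i) (e j)).toBlocks₂₂ := by
        rw [isUnit_iff_isUnit_det]
        simpa [toBlocks₂₂, he] using hu
      obtain ⟨α, β, hαβ, hequiv⟩ := hsub.exists_schur hunit
      exact (ih hαβ).fromBlocks_one.of_pairEquiv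
        ((pairEquiv_submatrix φ ψ (e i) (e j)).trans hequiv)
    by_cases hφ : ∃ i j, IsUnit (φ i j)
    · obtain ⟨i, j, hu⟩ := hφ
      exact step h i j hu
    by_cases hψ : ∃ i j, IsUnit (ψ i j)
    · obtain ⟨i, j, hu⟩ := hψ
      exact (step h.symm i j hu).swap
    push Not at hφ hψ
    refine ⟨n + 1, 0, 0, φ, ψ, h, fun i j => ⟨hφ i j, hψ i j⟩, ?_⟩
    let e : Fin (n + 1) ⊕ (Fin 0 ⊕ Fin 0) ≃ Fin (n + 1) := Equiv.sumEmpty _ _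
    convert pairEquiv_submatrix φ ψ e e using 1 <;>
    · ext (i | i | i) (j | j | j)
      all_goals first | rfl | exact i.elim0 | exact j.elim0

end Local

end Matrix

theorem statement16 (S : Type u) [CommRing S] [IsDomain S] [IsLocalRing S]
    (f : S) (hf0 : f ≠ 0) (hfm : f ∈ IsLocalRing.maximalIdeal S)
    -- `(φ, ψ)` is a matrix factorization of `f` of size `n`
    (n : ℕ) (φ ψ : Matrix (Fin n) (Fin n) S)
    (hφψ : φ * ψ = f • (1 : Matrix (Fin n) (Fin n) S))
    (hψφ : ψ * φ = f • (1 : Matrix (Fin n) (Fin n) S)) :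
    -- then `(φ, ψ) ∼ (α, β) ⊕ (f·I_t, I_t) ⊕ (I_r, f·I_r)` with `(α, β)` reduced
    ∃ k t r : ℕ, k + t + r = n ∧
      ∃ α β : Matrix (Fin k) (Fin k) S,
        α * β = f • (1 : Matrix (Fin k) (Fin k) S) ∧
        β * α = f • (1 : Matrix (Fin k) (Fin k) S) ∧
        (∀ i j, α i j ∈ IsLocalRing.maximalIdeal S ∧ β i j ∈ IsLocalRing.maximalIdeal S) ∧
        ∃ (σ : (Fin k ⊕ (Fin t ⊕ Fin r)) ≃ Fin n) (V W : Matrix (Fin n) (Fin n) S),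
          IsUnit V ∧ IsUnit W ∧
          -- `V φ = (α ⊕ f·I_t ⊕ I_r) W`
          V * φ = (Matrix.reindex σ σ
            (Matrix.fromBlocks α 0 0
              (Matrix.fromBlocks (f • (1 : Matrix (Fin t) (Fin t) S)) 0 0
                (1 : Matrix (Fin r) (Fin r) S)))) * W ∧
          -- `W ψ = (β ⊕ I_t ⊕ f·I_r) V`
          W * ψ = (Matrix.reindex σ σ
            (Matrix.fromBlocks β 0 0
              (Matrix.fromBlocks (1 : Matrix (Fin t) (Fin t) S) 0 0
                (f • (1 : Matrix (Fin r) (Fin r) S))))) * V := by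
  have hfac : Matrix.IsFactorization f φ ψ := ⟨hφψ, hψφ⟩
  obtain ⟨k, t, r, α, β, hαβ, hred, hequiv⟩ := hfac.hasReducedSplitting
  have hcard := hequiv.card_eq
  have hn : k + t + r = n := by simpa [add_assoc] using hcard
  refine ⟨k, t, r, hn, α, β, hαβ.1, hαβ.2, hred, Fintype.equivOfCardEq hcard, ?_⟩
  generalize Fintype.equivOfCardEq hcard = σ
  obtain ⟨V, V', W, W', h1, h2, h3, h4, h5, h6⟩ :=
    hequiv.trans (Matrix.pairEquiv_submatrix _ _ σ.symm σ.symm)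
  exact ⟨V, W, ⟨⟨V, V', h1, h2⟩, rfl⟩, ⟨⟨W, W', h3, h4⟩, rfl⟩, h5, h6⟩
end
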